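/- arXiv:2012.15634 — 9 statements merged into one kernel-verified Lean document; each statement's English description precedes it below -/
import Mathlib

section
/- Let D be a coherent acyclic orientation of a cut subgraph of G. Then σ_D = F_ℝ ∩ σ_{𝔼(D)}: an element of the cut space F_ℝ lies in the cone generated by the bond elements β with supp⁺(β) ⊆ 𝔼(D) if and only if it lies in the cone generated by the elements χ_e − χ_ē for e ∈ 𝔼(D). -/
open scoped Classical

/-- A finite loopless multigraph presented by its set of *oriented* edges:
each edge gives rise to two oriented edges, swapped by the fixed-point-free
involution `rev`. -/
structure OrGraph where
  V : Type
  EO : Type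
  fintV : Fintype V
  fintEO : Fintype EO
  decV : DecidableEq V
  decEO : DecidableEq EO
  rev : EO → EO
  tail : EO → V
  head : EO → V
  rev_rev : ∀ e, rev (rev e) = e
  rev_ne : ∀ e, rev e ≠ e
  head_rev : ∀ e, head (rev e) = tail e
  tail_rev : ∀ e, tail (rev e) = head e

attribute [instance] OrGraph.fintV OrGraph.fintEO OrGraph.decV OrGraph.decEO

namespace OrGraph

variable (G : OrGraph)

/-- Adjacency: there is an oriented edge from `u` to `v`. -/
def Adj (u v : G.V) : Prop := ∃ e, G.tail e = u ∧ G.head e = v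

/-- The graph is connected. -/
def Connected : Prop := ∀ u v : G.V, Relation.ReflTransGen G.Adj u v

/-- `g : 𝔼 → A` is a 1-cochain, i.e. `g(ē) = -g(e)`. -/
def IsC1 {A : Type} [Neg A] (g : G.EO → A) : Prop := ∀ e, g (G.rev e) = - g e

/-- The differential `d : C^0(G,A) → C^1(G,A)`, `d(f)(uv) = f(v) - f(u)`. -/
def d {A : Type} [Sub A] (f : G.V → A) : G.EO → A :=
  fun e => f (G.head e) - f (G.tail e)

/-- The adjoint `d* : C^1(G,A) → C^0(G,A)`, `d*(g)(v) = ∑_{head e = v} g(e)`. -/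
def dstar {A : Type} [AddCommMonoid A] (g : G.EO → A) : G.V → A :=
  fun v => ∑ e ∈ Finset.univ.filter (fun e => G.head e = v), g e

/-- The 1-cochain `χ_e - χ_ē`: value `1` at `e`, `-1` at `ē`, `0` elsewhere. -/
def chi (A : Type) [Zero A] [One A] [Neg A] (e : G.EO) : G.EO → A :=
  fun f => if f = e then 1 else if f = G.rev e then -1 else 0

/-- The set `S ⊆ V` induces a connected subgraph. -/
def ConnectedOn (S : Set G.V) : Prop :=
  ∀ u ∈ S, ∀ v ∈ S,
    Relation.ReflTransGen (fun a b => a ∈ S ∧ b ∈ S ∧ G.Adj a b) u v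

/-- `β` is a bond element: `β = d(χ_X)` with `X` nonempty, proper, and both
`G[X]` and `G[V-X]` connected. -/
def IsBond (β : G.EO → ℝ) : Prop :=
  ∃ X : Finset G.V, X.Nonempty ∧ Xᶜ.Nonempty ∧
    G.ConnectedOn ↑X ∧ G.ConnectedOn ↑(Xᶜ) ∧
    β = G.d (fun v => if v ∈ X then (1 : ℝ) else 0)

/-- The positive support of a real 1-cochain. -/
def suppPlus (x : G.EO → ℝ) : Set G.EO := {e | 0 < x e}

/-- The cone generated by a set of vectors: all finite nonnegative combinations. -/
def coneGen (S : Set (G.EO → ℝ)) : Set (G.EO → ℝ) :=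
  { x | ∃ (t : Finset (G.EO → ℝ)) (c : (G.EO → ℝ) → ℝ),
      (∀ y ∈ t, y ∈ S) ∧ (∀ y ∈ t, 0 ≤ c y) ∧ x = ∑ y ∈ t, c y • y }

/-- `D ⊆ 𝔼` is a coherent acyclic orientation of a cut subgraph of `G`:
for some ordered partition of `V` (encoded by `r : V → ℕ`), `D` consists of
the oriented edges going from a smaller part to a bigger part. -/
def IsCAC (D : Set G.EO) : Prop :=
  ∃ r : G.V → ℕ, D = {e | r (G.tail e) < r (G.head e)}

/-- The cone `σ_D` generated by the bond elements with positive support in `D`. -/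
def bondCone (D : Set G.EO) : Set (G.EO → ℝ) :=
  G.coneGen {β | G.IsBond β ∧ G.suppPlus β ⊆ D}

/-- The cone `σ_{𝔼(D)}` generated by the `χ_e - χ_ē` for `e ∈ D`. -/
def edgeCone (D : Set G.EO) : Set (G.EO → ℝ) :=
  G.coneGen {x | ∃ e ∈ D, x = G.chi ℝ e}

/-- The cut space `F_ℝ`, the image of `d : C^0(G,ℝ) → C^1(G,ℝ)`. -/
def cutSpace : Set (G.EO → ℝ) := {x | ∃ f : G.V → ℝ, x = G.d f}

/-- `γ` is an oriented cycle: a nonempty cyclic sequence of oriented edges with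
pairwise distinct underlying edges, the head of each being the tail of the next. -/
def IsCycle (γ : List G.EO) : Prop :=
  γ ≠ [] ∧
  (∀ i : Fin γ.length,
    G.head (γ.get i) = G.tail (γ.get ⟨((i : ℕ) + 1) % γ.length, Nat.mod_lt _ i.pos⟩)) ∧
  (∀ i j : Fin γ.length, i ≠ j → γ.get i ≠ γ.get j ∧ γ.get i ≠ G.rev (γ.get j))

/-- `δ^{𝔪,n}_e(f) = ⌊(f(head e) - f(tail e) + n 𝔪_e)/(n ℓ_e)⌋`. -/
def ddelta (ℓ : G.EO → ℕ) (m : G.EO → ℤ) (n : ℕ) (f : G.V → ℤ) (e : G.EO) : ℤ :=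
  ⌊((f (G.head e) : ℚ) - (f (G.tail e) : ℚ) + (n : ℚ) * (m e : ℚ)) /
    ((n : ℚ) * (ℓ e : ℚ))⌋

/-- `𝔡^{𝔪,n}_f(e) = (δ^{𝔪,n}_e(f) - δ^{𝔪,n}_{ē}(f))/2`. -/
def dd (ℓ : G.EO → ℕ) (m : G.EO → ℤ) (n : ℕ) (f : G.V → ℤ) (e : G.EO) : ℚ :=
  ((G.ddelta ℓ m n f e : ℚ) - (G.ddelta ℓ m n f (G.rev e) : ℚ)) / 2

end OrGraph

namespace OrGraph

variable {G : OrGraph}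

section Cone

variable {S : Set (G.EO → ℝ)}

lemma zero_mem_coneGen : (0 : G.EO → ℝ) ∈ G.coneGen S :=
  ⟨∅, fun _ => 0, by simp, by simp, by simp⟩

lemma add_smul_mem_coneGen {x y : G.EO → ℝ} {a : ℝ} (hx : x ∈ G.coneGen S) (hy : y ∈ S)
    (ha : 0 ≤ a) : x + a • y ∈ G.coneGen S := by
  obtain ⟨t, c, htS, hc, rfl⟩ := hx
  refine ⟨insert y t, fun z => (if z ∈ t then c z else 0) + if z = y then a else 0, ?_, ?_, ?_⟩
  · intro z hz
    rcases Finset.mem_insert.1 hz with rfl | hz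
    exacts [hy, htS z hz]
  · intro z _
    refine add_nonneg ?_ ?_
    · split_ifs with h
      exacts [hc z h, le_rfl]
    · split_ifs
      exacts [ha, le_rfl]
  · simp only [add_smul, Finset.sum_add_distrib, ite_smul, zero_smul]
    congr 1
    · rw [← Finset.sum_filter]
      refine Finset.sum_congr ?_ fun _ _ => rfl
      ext z
      simp only [Finset.mem_filter, Finset.mem_insert]
      tauto
    · simp

lemma sum_smul_mem_coneGen {ι : Type} (s : Finset ι) (a : ι → ℝ) (y : ι → G.EO → ℝ)
    (ha : ∀ i ∈ s, 0 ≤ a i) (hy : ∀ i ∈ s, y i ∈ S) :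
    ∑ i ∈ s, a i • y i ∈ G.coneGen S := by
  induction s using Finset.induction_on with
  | empty => simpa using zero_mem_coneGen
  | insert i s hi ih =>
    rw [Finset.sum_insert hi, add_comm]
    exact add_smul_mem_coneGen
      (ih (fun j hj => ha j (Finset.mem_insert_of_mem hj))
        fun j hj => hy j (Finset.mem_insert_of_mem hj))
      (hy i (Finset.mem_insert_self i s)) (ha i (Finset.mem_insert_self i s))

lemma suppPlus_subset_of_mem_coneGen {D : Set G.EO} {x : G.EO → ℝ} (hx : x ∈ G.coneGen S)
    (hS : ∀ y ∈ S, G.suppPlus y ⊆ D) : G.suppPlus x ⊆ D := by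
  obtain ⟨t, c, htS, hc, rfl⟩ := hx
  intro e he
  by_contra heD
  refine absurd (show 0 < (∑ y ∈ t, c y • y) e from he) (not_lt.2 ?_)
  rw [Finset.sum_apply]
  refine Finset.sum_nonpos fun y hy => mul_nonpos_of_nonneg_of_nonpos (hc y hy) ?_
  by_contra h
  exact heD (hS y (htS y hy) (not_le.1 h))

lemma coneGen_subset_cutSpace (hS : S ⊆ G.cutSpace) : G.coneGen S ⊆ G.cutSpace := by
  rintro _ ⟨t, c, htS, -, rfl⟩
  choose! f hf using fun y (hy : y ∈ S) => hS hy
  refine ⟨∑ y ∈ t, c y • f y, ?_⟩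
  ext e
  simp only [d, Finset.sum_apply, Pi.smul_apply, smul_eq_mul, ← Finset.sum_sub_distrib,
    ← mul_sub]
  exact Finset.sum_congr rfl fun y hy => congrArg (c y * ·) (congrFun (hf y (htS y hy)) e)

end Cone

lemma d_rev (f : G.V → ℝ) : G.IsC1 (G.d f) := by
  intro e
  simp [d, G.head_rev, G.tail_rev]

lemma suppPlus_chi (e : G.EO) : G.suppPlus (G.chi ℝ e) ⊆ {e} := by
  intro f hf
  by_contra h
  have h' : f ≠ e := h
  simp only [suppPlus, chi, Set.mem_ofPred_eq, if_neg h'] at hf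
  split_ifs at hf <;> linarith

lemma chi_apply (e f : G.EO) :
    G.chi ℝ e f = (if f = e then 1 else 0) - if G.rev f = e then 1 else 0 := by
  have h : f = G.rev e ↔ G.rev f = e :=
    ⟨fun h => by rw [h, G.rev_rev], fun h => by rw [← h, G.rev_rev]⟩
  by_cases h1 : f = e
  · subst h1
    simp [chi, G.rev_ne]
  · by_cases h2 : G.rev f = e <;> simp [chi, h, h1, h2]

lemma eq_sum_smul_chi {x : G.EO → ℝ} (hx : G.IsC1 x) :
    x = ∑ e ∈ Finset.univ.filter (fun e => 0 < x e), x e • G.chi ℝ e := by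
  ext f
  have hr := hx f
  simp only [Finset.sum_apply, Pi.smul_apply, smul_eq_mul, chi_apply, mul_sub, mul_ite, mul_one,
    mul_zero, Finset.sum_sub_distrib, Finset.sum_ite_eq, Finset.mem_filter, Finset.mem_univ,
    true_and]
  split_ifs <;> linarith

lemma mem_edgeCone_iff {D : Set G.EO} {x : G.EO → ℝ} (hx : G.IsC1 x) :
    x ∈ G.edgeCone D ↔ G.suppPlus x ⊆ D := by
  constructor
  · intro h
    refine suppPlus_subset_of_mem_coneGen h ?_
    rintro _ ⟨e, he, rfl⟩
    exact (suppPlus_chi e).trans (Set.singleton_subset_iff.2 he)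
  · intro h
    rw [eq_sum_smul_chi hx]
    exact sum_smul_mem_coneGen _ _ _ (fun e he => (Finset.mem_filter.1 he).2.le)
      fun e he => ⟨e, h (Finset.mem_filter.1 he).2, rfl⟩

lemma Adj.symm {u v : G.V} (h : G.Adj u v) : G.Adj v u := by
  obtain ⟨e, rfl, rfl⟩ := h
  exact ⟨G.rev e, G.tail_rev e, G.head_rev e⟩

variable (G) in
/-- Adjacency inside the subgraph induced by `S`. -/
def AdjOn (S : Set G.V) (a b : G.V) : Prop := a ∈ S ∧ b ∈ S ∧ G.Adj a b

variable (G) in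
/-- The connected component of `v` in the subgraph induced by `S`. -/
def component (S : Set G.V) (v : G.V) : Set G.V := {w | Relation.ReflTransGen (G.AdjOn S) v w}

lemma AdjOn.mono {S T : Set G.V} (h : S ⊆ T) {a b : G.V} (hab : G.AdjOn S a b) :
    G.AdjOn T a b :=
  ⟨h hab.1, h hab.2.1, hab.2.2⟩

lemma reachableOn_symm {S : Set G.V} {u v : G.V}
    (h : Relation.ReflTransGen (G.AdjOn S) u v) : Relation.ReflTransGen (G.AdjOn S) v u := by
  induction h with
  | refl => exact .refl
  | tail _ hab ih => exact ih.head ⟨hab.2.1, hab.1, hab.2.2.symm⟩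

lemma connectedOn_of_forall_reachable {S : Set G.V} (v : G.V)
    (h : ∀ w ∈ S, Relation.ReflTransGen (G.AdjOn S) v w) : G.ConnectedOn S :=
  fun a ha b hb => (reachableOn_symm (h a ha)).trans (h b hb)

lemma mem_component_self (S : Set G.V) (v : G.V) : v ∈ G.component S v :=
  Relation.ReflTransGen.refl

lemma component_subset {S : Set G.V} {v : G.V} (hv : v ∈ S) : G.component S v ⊆ S := by
  intro w hw
  rcases Relation.ReflTransGen.cases_tail hw with rfl | ⟨_, _, h⟩
  exacts [hv, h.2.1]

lemma mem_component_of_adj {S : Set G.V} {v a b : G.V} (hv : v ∈ S)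
    (ha : a ∈ G.component S v) (hb : b ∈ S) (hab : G.Adj a b) : b ∈ G.component S v :=
  Relation.ReflTransGen.tail ha ⟨component_subset hv ha, hb, hab⟩

lemma reachableOn_component {S : Set G.V} {v w : G.V} (hw : w ∈ G.component S v) :
    Relation.ReflTransGen (G.AdjOn (G.component S v)) v w := by
  induction hw with
  | refl => exact .refl
  | tail h hab ih => exact ih.tail ⟨h, h.tail hab, hab.2.2⟩

lemma connectedOn_component (S : Set G.V) (v : G.V) : G.ConnectedOn (G.component S v) :=
  connectedOn_of_forall_reachable v fun _ => reachableOn_component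

/-- In a connected graph, removing a component of the complement of a connected set leaves a
connected set. -/
lemma connectedOn_compl_component (hconn : G.Connected) {A : Set G.V} {u v : G.V}
    (hA : G.ConnectedOn A) (hv : v ∈ A) (hu : u ∉ A) :
    G.ConnectedOn (G.component Aᶜ u)ᶜ := by
  have hAB : A ⊆ (G.component Aᶜ u)ᶜ := fun w hw hwB => component_subset hu hwB hw
  refine connectedOn_of_forall_reachable v fun w hw => reachableOn_symm ?_
  induction hconn w v using Relation.ReflTransGen.head_induction_on with
  | refl => exact .refl
  | @head a c hac _ ih =>
    by_cases hc : c ∈ G.component Aᶜ u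
    · have ha : a ∈ A := by
        by_contra ha
        exact hw (mem_component_of_adj hu hc ha hac.symm)
      exact (hA a ha v hv).lift id fun _ _ => AdjOn.mono hAB
    · exact (ih hc).head ⟨hw, hc, hac⟩

/-- Every edge in the positive support of a cut lies in the positive support of a bond which is
contained in the positive support of the cut. -/
lemma exists_bond_of_pos (hconn : G.Connected) (f : G.V → ℝ) {e : G.EO} (he : 0 < G.d f e) :
    ∃ g : G.V → ℝ, G.IsBond (G.d g) ∧ G.suppPlus (G.d g) ⊆ G.suppPlus (G.d f) ∧
      G.d g e = 1 ∧ ∀ e', 0 < G.d g e' → G.d g e' = 1 := by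
  set v := G.head e with hv
  set u := G.tail e with hu
  have huv : f u < f v := sub_pos.1 he
  set L : Set G.V := {w | f v ≤ f w}
  have hvL : v ∈ L := le_refl (f v)
  set A := G.component L v with hA
  have hvA : v ∈ A := mem_component_self L v
  have huA : u ∉ A := fun h => absurd (component_subset hvL h : f v ≤ f u) (not_le.2 huv)
  set B := G.component Aᶜ u with hB
  have huB : u ∈ B := mem_component_self _ u
  have hvB : v ∉ B := fun h => component_subset huA h hvA
  set X : Finset G.V := Bᶜ.toFinset with hX
  have hXmem : ∀ w, w ∈ X ↔ w ∉ B := by simp [hX]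
  have hXB : (X : Set G.V) = Bᶜ := by simp [hX]
  have hXB' : ((Xᶜ : Finset G.V) : Set G.V) = B := by simp [hX]
  have hval : ∀ e', 0 < G.d (fun w => if w ∈ X then (1 : ℝ) else 0) e' →
      G.tail e' ∈ B ∧ G.head e' ∉ B := by
    intro e' he'
    simp only [d, hXmem] at he'
    by_cases h1 : G.tail e' ∈ B <;> by_cases h2 : G.head e' ∈ B <;>
      simp [h1, h2] at he' ⊢
    linarith
  refine ⟨fun w => if w ∈ X then 1 else 0, ⟨X, ⟨v, (hXmem v).2 hvB⟩, ⟨u, ?_⟩, ?_, ?_, rfl⟩,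
    ?_, ?_, ?_⟩
  · simpa [hXmem] using huB
  · rw [hXB]
    exact connectedOn_compl_component hconn (connectedOn_component L v) hvA huA
  · rw [hXB']
    exact connectedOn_component _ u
  · intro e' he'
    obtain ⟨ht, hh⟩ := hval e' he'
    have hadj : G.Adj (G.tail e') (G.head e') := ⟨e', rfl, rfl⟩
    have hhA : G.head e' ∈ A := by
      by_contra h
      exact hh (mem_component_of_adj huA ht h hadj)
    have htL : G.tail e' ∉ L := fun h =>
      component_subset huA ht (mem_component_of_adj hvL hhA h hadj.symm)
    have hhL : f v ≤ f (G.head e') := component_subset hvL hhA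
    have htL' : f (G.tail e') < f v := not_le.1 htL
    exact sub_pos.2 (htL'.trans_le hhL)
  · simp [d, hXmem, ← hv, ← hu, hvB, huB]
  · intro e' he'
    obtain ⟨ht, hh⟩ := hval e' he'
    simp [d, hXmem, ht, hh]

/-- A cut is a nonnegative combination of bonds supported in its positive support. -/
lemma d_mem_bondCone (hconn : G.Connected) {D : Set G.EO} (f : G.V → ℝ)
    (hf : G.suppPlus (G.d f) ⊆ D) : G.d f ∈ G.bondCone D := by
  induction hn : (Finset.univ.filter fun e => 0 < G.d f e).card using Nat.strong_induction_on
    generalizing f with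
  | _ n ih =>
  subst hn
  by_cases hpos : ∃ e, 0 < G.d f e
  swap
  · have h0 : G.d f = 0 := by
      ext e
      have h1 := not_lt.1 (not_exists.1 hpos e)
      have h2 := not_lt.1 (not_exists.1 hpos (G.rev e))
      rw [d_rev f e] at h2
      exact le_antisymm h1 (by simpa using h2)
    rw [h0]
    exact zero_mem_coneGen
  obtain ⟨e₀, he₀⟩ := hpos
  obtain ⟨g, hbond, hsub, hg₀, hg⟩ := exists_bond_of_pos hconn f he₀
  obtain ⟨e₁, he₁, hmin⟩ := Finset.exists_min_image
    (Finset.univ.filter fun e => 0 < G.d g e) (G.d f) ⟨e₀, by simp [hg₀]⟩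
  simp only [Finset.mem_filter, Finset.mem_univ, true_and] at he₁ hmin
  set m := G.d f e₁ with hm
  have hm0 : 0 < m := hsub he₁
  have hd : ∀ e, G.d (f - m • g) e = G.d f e - m * G.d g e := by
    intro e
    simp only [d, Pi.sub_apply, Pi.smul_apply, smul_eq_mul]
    ring
  have hsub' : G.suppPlus (G.d (f - m • g)) ⊆ G.suppPlus (G.d f) := by
    intro e he
    have he' : 0 < G.d f e - m * G.d g e := hd e ▸ he
    by_contra hfe
    have hfe' : G.d f e ≤ 0 := not_lt.1 hfe
    have hge : G.d g e < 0 := by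
      by_contra h
      nlinarith [mul_nonneg hm0.le (not_lt.1 h)]
    have hgr : 0 < G.d g (G.rev e) := by
      rw [d_rev g e]
      linarith
    have h1 := hg _ hgr
    have h2 := hmin _ hgr
    rw [d_rev g e] at h1
    rw [d_rev f e] at h2
    have h3 : G.d g e = -1 := by linarith
    rw [h3] at he'
    linarith
  have hlt : (Finset.univ.filter fun e => 0 < G.d (f - m • g) e).card <
      (Finset.univ.filter fun e => 0 < G.d f e).card := by
    refine Finset.card_lt_card ((Finset.ssubset_iff_of_subset ?_).2 ⟨e₁, ?_, ?_⟩)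
    · intro e he
      exact Finset.mem_filter.2 ⟨Finset.mem_univ e, hsub' (Finset.mem_filter.1 he).2⟩
    · simpa using hm0
    · simp [hd, hg e₁ he₁, ← hm]
  have key := ih _ hlt (f - m • g) (hsub'.trans hf) rfl
  have heq : G.d f = G.d (f - m • g) + m • G.d g := by
    ext e
    simp [hd]
  rw [heq]
  exact add_smul_mem_coneGen key ⟨hbond, hsub.trans hf⟩ hm0.le

end OrGraph

/-- `σ_D = F_ℝ ∩ σ_{𝔼(D)}` for a coherent acyclic orientation `D`
of a cut subgraph of `G`. -/
theorem bondCone_eq_cutSpace_inter_edgeCone (G : OrGraph) (hconn : G.Connected)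
    (D : Set G.EO) (hD : G.IsCAC D) :
    G.bondCone D = G.cutSpace ∩ G.edgeCone D := by
  ext x
  constructor
  · intro hx
    have hcut : x ∈ G.cutSpace := by
      refine OrGraph.coneGen_subset_cutSpace ?_ hx
      rintro _ ⟨⟨X, -, -, -, -, rfl⟩, -⟩
      exact ⟨_, rfl⟩
    obtain ⟨f, rfl⟩ := hcut
    exact ⟨⟨f, rfl⟩, (OrGraph.mem_edgeCone_iff (OrGraph.d_rev f)).2
      (OrGraph.suppPlus_subset_of_mem_coneGen hx fun _ hy => hy.2)⟩
  · rintro ⟨⟨f, rfl⟩, hx⟩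
    exact OrGraph.d_mem_bondCone hconn f ((OrGraph.mem_edgeCone_iff (OrGraph.d_rev f)).1 hx)
end

section
/- Let D be a coherent acyclic orientation of a cut subgraph of G. Let φ ∈ F_ℝ satisfy ⟨φ, β⟩ ≥ 0 for every bond element β with supp⁺(β) ⊆ 𝔼(D). Then there exists η ∈ C^1(G,ℝ) with η(e) ≥ 0 for every e ∈ 𝔼(D) and d*(η) = d*(φ) (equivalently, the orthogonal projection of η onto F_ℝ equals φ). Moreover, if φ ∈ F_ℤ, then η may be taken in C^1(G,ℤ). -/
open scoped Classical

/-- A function of total sum zero whose sum over every upper set is nonnegative is a sum of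
elementary transports from smaller to larger elements of the preorder. -/
theorem mem_addSubmonoid_of_sum_upper_nonneg {V A : Type*} [DecidableEq V] [AddCommGroup A]
    [LinearOrder A] [IsOrderedAddMonoid A] (L : AddSubmonoid (V → A)) (le : V → V → Prop)
    (le_refl : ∀ x, le x x) (le_trans : ∀ x y z, le x y → le y z → le x z)
    (transport_mem : ∀ u v, le u v → ∀ t : A, 0 ≤ t → Pi.single v t - Pi.single u t ∈ L)
    (S : Finset V) (c : V → A) (hsupp : ∀ x ∉ S, c x = 0) (htotal : ∑ x ∈ S, c x = 0)
    (hupper : ∀ Y ⊆ S, (∀ x ∈ Y, ∀ y ∈ S, le x y → y ∈ Y) → 0 ≤ ∑ x ∈ Y, c x) :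
    c ∈ L := by
  induction hn : S.card using Nat.strong_induction_on generalizing S c with
  | _ n ih =>
  have sum_move : ∀ (Y : Finset V) (u v : V) (t : A),
      ∑ x ∈ Y, (c - (Pi.single v t - Pi.single u t : V → A)) x =
        ∑ x ∈ Y, c x - ((if v ∈ Y then t else 0) - (if u ∈ Y then t else 0)) := by
    intro Y u v t
    simp [Finset.sum_sub_distrib]
  by_cases hcomp : ∃ u ∈ S, ∃ v ∈ S, u ≠ v ∧ le u v
  · obtain ⟨u, hu, v, hv, huv, hle⟩ := hcomp
    by_cases hle' : le v u
    · -- `u` and `v` are equivalent: transport all of `c v` to `u` and discard `v`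
      have hmove : (Pi.single v (c v) - Pi.single u (c v) : V → A) ∈ L := by
        rcases _root_.le_total 0 (c v) with h | h
        · exact transport_mem u v hle _ h
        · have := transport_mem v u hle' (-c v) (neg_nonneg.2 h)
          rw [Pi.single_neg, Pi.single_neg] at this
          convert this using 1
          abel
      have hzero : (c - (Pi.single v (c v) - Pi.single u (c v) : V → A)) v = 0 := by
        simp [Pi.single_eq_of_ne huv.symm]
      have hrest : c - (Pi.single v (c v) - Pi.single u (c v)) ∈ L := by
        refine ih _ ?_ (S.erase v) _ ?_ ?_ ?_ rfl
        · rw [← hn]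
          exact Finset.card_erase_lt_of_mem hv
        · intro x hx
          by_cases hxv : x = v
          · rw [hxv, hzero]
          · have hxS : x ∉ S := fun h => hx (Finset.mem_erase.2 ⟨hxv, h⟩)
            have hxu : x ≠ u := fun h => hxS (h ▸ hu)
            simp [Pi.single_eq_of_ne hxv, Pi.single_eq_of_ne hxu, hsupp x hxS]
        · rw [Finset.sum_erase _ hzero, sum_move]
          simp [hu, hv, htotal]
        · intro Y hY hYup
          have hvY : v ∉ Y := fun h => by simpa using hY h
          have hYS : Y ⊆ S := hY.trans (Finset.erase_subset _ _)
          by_cases huY : u ∈ Y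
          · have hins : ∑ x ∈ insert v Y, (c - (Pi.single v (c v) - Pi.single u (c v) : V → A)) x
                = ∑ x ∈ Y, (c - (Pi.single v (c v) - Pi.single u (c v) : V → A)) x := by
              rw [Finset.sum_insert hvY, hzero, zero_add]
            rw [← hins, sum_move]
            simp only [Finset.mem_insert, huY, true_or, or_true, if_true, sub_self, sub_zero]
            refine hupper _ (Finset.insert_subset hv hYS) ?_
            intro x hx y hy hxy
            by_cases hyv : y = v
            · simp [hyv]
            · refine Finset.mem_insert_of_mem ?_
              rcases Finset.mem_insert.1 hx with rfl | hx
              · exact hYup u huY y (Finset.mem_erase.2 ⟨hyv, hy⟩) (le_trans _ _ _ hle hxy)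
              · exact hYup x hx y (Finset.mem_erase.2 ⟨hyv, hy⟩) hxy
          · rw [sum_move]
            simp only [huY, hvY, if_false, sub_self, sub_zero]
            refine hupper _ hYS ?_
            intro x hx y hy hxy
            by_cases hyv : y = v
            · subst hyv
              exact absurd (hYup x hx u (Finset.mem_erase.2 ⟨huv, hu⟩)
                (le_trans _ _ _ hxy hle')) huY
            · exact hYup x hx y (Finset.mem_erase.2 ⟨hyv, hy⟩) hxy
      simpa using L.add_mem hrest hmove
    · -- transport as much as possible from `u` to `v`, then split along a tight upper set
      obtain ⟨X, hX, hmin⟩ := Finset.exists_min_image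
        (S.powerset.filter fun Y =>
          (∀ x ∈ Y, ∀ y ∈ S, le x y → y ∈ Y) ∧ v ∈ Y ∧ u ∉ Y)
        (fun Y => ∑ x ∈ Y, c x)
        ⟨S.filter fun y => le v y, by
          simp only [Finset.mem_filter, Finset.mem_powerset]
          refine ⟨Finset.filter_subset _ _, ?_, ⟨hv, le_refl v⟩, fun h => hle' h.2⟩
          exact fun x hx y hy hxy => ⟨hy, le_trans _ _ _ hx.2 hxy⟩⟩
      simp only [Finset.mem_filter, Finset.mem_powerset] at hX hmin
      obtain ⟨hXS, hXup, hvX, huX⟩ := hX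
      obtain ⟨t, ht⟩ : ∃ t, t = ∑ x ∈ X, c x := ⟨_, rfl⟩
      have ht0 : 0 ≤ t := ht ▸ hupper X hXS hXup
      obtain ⟨c', hc'⟩ : ∃ c' : V → A, c' = c - (Pi.single v t - Pi.single u t) := ⟨_, rfl⟩
      have hsum : ∀ Y : Finset V, ∑ x ∈ Y, c' x =
          ∑ x ∈ Y, c x - ((if v ∈ Y then t else 0) - (if u ∈ Y then t else 0)) := by
        intro Y
        rw [hc', sum_move]
      have hX0 : ∑ x ∈ X, c' x = 0 := by
        rw [hsum]
        simp [hvX, huX, ht]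
      have hS0 : ∑ x ∈ S, c' x = 0 := by
        rw [hsum]
        simp [hu, hv, htotal]
      have hup' : ∀ Y ⊆ S, (∀ x ∈ Y, ∀ y ∈ S, le x y → y ∈ Y) → 0 ≤ ∑ x ∈ Y, c' x := by
        intro Y hYS hYup
        rw [hsum]
        by_cases huY : u ∈ Y
        · have hvY : v ∈ Y := hYup u huY v hv hle
          simpa [huY, hvY] using hupper Y hYS hYup
        · by_cases hvY : v ∈ Y
          · simpa [huY, hvY, ht] using hmin Y ⟨hYS, hYup, hvY, huY⟩
          · simpa [huY, hvY] using hupper Y hYS hYup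
      have hsupp' : ∀ x ∉ S, c' x = 0 := by
        intro x hx
        have hxu : x ≠ u := fun h => hx (h ▸ hu)
        have hxv : x ≠ v := fun h => hx (h ▸ hv)
        simp [hc', Pi.single_eq_of_ne hxv, Pi.single_eq_of_ne hxu, hsupp x hx]
      have hsdiff : ∑ x ∈ S \ X, c' x = 0 := by
        have := Finset.sum_sdiff (f := c') hXS
        rwa [hX0, hS0, add_zero] at this
      have hin : (fun x => if x ∈ X then c' x else 0) ∈ L := by
        refine ih _ ?_ X _ ?_ ?_ ?_ rfl
        · rw [← hn]
          exact Finset.card_lt_card ((Finset.ssubset_iff_of_subset hXS).2 ⟨u, hu, huX⟩)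
        · intro x hx
          simp [hx]
        · rw [← hX0]
          exact Finset.sum_congr rfl fun x hx => by simp [hx]
        · intro Y hY hYup
          rw [Finset.sum_congr rfl fun x hx => if_pos (hY hx)]
          exact hup' Y (hY.trans hXS) fun x hx y hy hxy =>
            hYup x hx y (hXup x (hY hx) y hy hxy) hxy
      have hout : (fun x => if x ∈ S \ X then c' x else 0) ∈ L := by
        refine ih _ ?_ (S \ X) _ ?_ ?_ ?_ rfl
        · rw [← hn]
          exact Finset.card_lt_card ((Finset.ssubset_iff_of_subset Finset.sdiff_subset).2
            ⟨v, hv, by simp [hvX]⟩)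
        · intro x hx
          simp only [hx, if_false]
        · rw [← hsdiff]
          exact Finset.sum_congr rfl fun x hx => if_pos hx
        · intro Y hY hYup
          rw [Finset.sum_congr rfl fun x hx => if_pos (hY hx)]
          have hdisj : Disjoint Y X :=
            Finset.disjoint_of_subset_left hY Finset.sdiff_disjoint
          have := hup' (Y ∪ X)
            (Finset.union_subset (hY.trans Finset.sdiff_subset) hXS) (by
              intro x hx y hy hxy
              by_cases hyX : y ∈ X
              · exact Finset.mem_union_right _ hyX
              · rcases Finset.mem_union.1 hx with hx | hx
                · exact Finset.mem_union_left _
                    (hYup x hx y (Finset.mem_sdiff.2 ⟨hy, hyX⟩) hxy)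
                · exact absurd (hXup x hx y hy hxy) hyX)
          rwa [Finset.sum_union hdisj, hX0, add_zero] at this
      have hsplit : c = ((fun x => if x ∈ X then c' x else 0) +
          fun x => if x ∈ S \ X then c' x else 0) + (Pi.single v t - Pi.single u t) := by
        have hc : c' = (fun x => if x ∈ X then c' x else 0) +
            fun x => if x ∈ S \ X then c' x else 0 := by
          funext x
          by_cases hxX : x ∈ X
          · simp [hxX]
          · by_cases hxS : x ∈ S
            · simp [hxX, hxS]
            · simp [hxX, hxS, hsupp' x hxS]
        rw [← hc, hc']
        abel
      rw [hsplit]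
      exact L.add_mem (L.add_mem hin hout) (transport_mem u v hle t ht0)
  · -- without comparable pairs, all singletons are upper sets
    have hnonneg : ∀ x ∈ S, 0 ≤ c x := by
      intro x hx
      have := hupper {x} (by simpa using hx) (by
        intro a ha y hy hay
        rw [Finset.mem_singleton] at ha ⊢
        by_contra hne
        exact hcomp ⟨a, ha ▸ hx, y, hy, fun h => hne (h ▸ ha), hay⟩)
      simpa using this
    have hzero : c = 0 := by
      funext x
      by_cases hx : x ∈ S
      · exact (Finset.sum_eq_zero_iff_of_nonneg hnonneg).1 htotal x hx
      · exact hsupp x hx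
    rw [hzero]
    exact L.zero_mem

namespace OrGraph

theorem sum_comp_rev {A : Type} [AddCommMonoid A] (G : OrGraph) (g : G.EO → A) :
    ∑ e, g (G.rev e) = ∑ e, g e :=
  Equiv.sum_comp (Function.Involutive.toPerm G.rev G.rev_rev) g

theorem sum_dstar {A : Type} [AddCommMonoid A] (G : OrGraph) (g : G.EO → A)
    (X : Finset G.V) :
    ∑ v ∈ X, G.dstar g v = ∑ e, if G.head e ∈ X then g e else 0 := by
  simp only [dstar]
  rw [← Finset.sum_filter]
  rw [← Finset.sum_fiberwise_of_maps_to (s := Finset.univ.filter fun e => G.head e ∈ X)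
    (t := X) (g := G.head) (by simp)]
  refine Finset.sum_congr rfl fun v hv => ?_
  refine Finset.sum_congr ?_ fun _ _ => rfl
  ext e
  simp only [Finset.mem_filter, Finset.mem_univ, true_and]
  exact ⟨fun h => ⟨h ▸ hv, h⟩, fun h => h.2⟩

theorem isC1_d {A : Type} [AddCommGroup A] (G : OrGraph) (f : G.V → A) :
    G.IsC1 (G.d f) := by
  intro e
  simp [d, G.head_rev, G.tail_rev]

/-- The pairing with `d(χ_X)` is the sum of `d*` over `X`. -/
theorem pairing_d_indicator (G : OrGraph) {φ : G.EO → ℝ} (hφ : G.IsC1 φ)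
    (X : Finset G.V) :
    (1 / 2) * ∑ e, φ e * G.d (fun v => if v ∈ X then (1 : ℝ) else 0) e =
      ∑ v ∈ X, G.dstar φ v := by
  have htail : ∑ e, φ e * (if G.tail e ∈ X then (1 : ℝ) else 0) =
      -∑ e, φ e * (if G.head e ∈ X then (1 : ℝ) else 0) := by
    rw [← G.sum_comp_rev, ← Finset.sum_neg_distrib]
    refine Finset.sum_congr rfl fun e _ => ?_
    rw [hφ e, G.tail_rev, neg_mul]
  rw [G.sum_dstar]
  simp only [d, mul_sub, Finset.sum_sub_distrib]
  rw [htail]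
  simp only [mul_ite, mul_one, mul_zero]
  ring

theorem sum_univ_dstar (G : OrGraph) {φ : G.EO → ℝ} (hφ : G.IsC1 φ) :
    ∑ v, G.dstar φ v = 0 := by
  rw [← G.pairing_d_indicator hφ]
  simp [d]

theorem exists_edge_entering (G : OrGraph) (hconn : G.Connected) {X : Finset G.V}
    {a b : G.V} (ha : a ∉ X) (hb : b ∈ X) : ∃ e, G.tail e ∉ X ∧ G.head e ∈ X := by
  by_contra hno
  push Not at hno
  have : ∀ w, Relation.ReflTransGen G.Adj a w → w ∉ X := by
    intro w hw
    induction hw with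
    | refl => exact ha
    | tail _ h ih =>
      obtain ⟨e, rfl, rfl⟩ := h
      exact hno e ih
  exact this b (hconn a b) hb

theorem exists_separation_of_not_connectedOn (G : OrGraph) {X : Finset G.V}
    (hX : ¬ G.ConnectedOn (X : Set G.V)) :
    ∃ Y Z : Finset G.V, Y.Nonempty ∧ Z.Nonempty ∧ Disjoint Y Z ∧ Y ∪ Z = X ∧
      ∀ e, (G.tail e ∈ Y → G.head e ∉ Z) ∧ (G.tail e ∈ Z → G.head e ∉ Y) := by
  simp only [ConnectedOn, not_forall] at hX
  obtain ⟨u, hu, v, hv, huv⟩ := hX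
  let reach : G.V → Prop :=
    Relation.ReflTransGen (fun a b => a ∈ (X : Set G.V) ∧ b ∈ (X : Set G.V) ∧ G.Adj a b) u
  have hstep : ∀ e, G.tail e ∈ X → G.head e ∈ X → reach (G.tail e) → reach (G.head e) :=
    fun e ht hh h => h.tail ⟨ht, hh, e, rfl, rfl⟩
  refine ⟨X.filter reach, X.filter fun w => ¬ reach w,
    ⟨u, Finset.mem_filter.2 ⟨hu, .refl⟩⟩, ⟨v, Finset.mem_filter.2 ⟨hv, huv⟩⟩,
    Finset.disjoint_filter_filter_not _ _ _, Finset.filter_union_filter_not_eq _ _, ?_⟩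
  intro e
  simp only [Finset.mem_filter]
  refine ⟨fun h h' => h'.2 (hstep e h.1 h'.1 h.2), fun h h' => h.2 ?_⟩
  have := hstep (G.rev e)
  rw [G.tail_rev, G.head_rev] at this
  exact this h'.1 h.1 h'.2

/-- If a function of total sum zero has nonnegative sum over the sides of all bonds directed
by `D`, then it has nonnegative sum over the sides of all cuts directed by `D`. -/
theorem sum_nonneg_of_bonds (G : OrGraph) (hconn : G.Connected) (D : Set G.EO)
    (c : G.V → ℝ) (htotal : ∑ v, c v = 0)
    (hbond : ∀ X : Finset G.V, X.Nonempty → Xᶜ.Nonempty → G.ConnectedOn (X : Set G.V) →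
      G.ConnectedOn (↑(Xᶜ) : Set G.V) → (∀ e, G.tail e ∉ X → G.head e ∈ X → e ∈ D) →
      0 ≤ ∑ v ∈ X, c v)
    (X : Finset G.V) (hX : ∀ e, G.tail e ∉ X → G.head e ∈ X → e ∈ D) :
    0 ≤ ∑ v ∈ X, c v := by
  induction hn : (Finset.univ.filter fun e => G.tail e ∉ X ∧ G.head e ∈ X).card
    using Nat.strong_induction_on generalizing X with
  | _ n ih =>
  have key : ∀ W : Finset G.V,
      (∀ e, G.tail e ∉ W → G.head e ∈ W → G.tail e ∉ X ∧ G.head e ∈ X) →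
      (∃ e, G.tail e ∉ X ∧ G.head e ∈ X ∧ ¬ (G.tail e ∉ W ∧ G.head e ∈ W)) →
      0 ≤ ∑ v ∈ W, c v := by
    rintro W hW ⟨e, he, he', heW⟩
    refine ih _ ?_ W (fun e h h' => hX e (hW e h h').1 (hW e h h').2) rfl
    rw [← hn]
    refine Finset.card_lt_card ((Finset.ssubset_iff_of_subset ?_).2 ⟨e, ?_, ?_⟩)
    · intro e h
      simp only [Finset.mem_filter, Finset.mem_univ, true_and] at h ⊢
      exact hW e h.1 h.2
    · simp [he, he']
    · simpa using heW
  rcases X.eq_empty_or_nonempty with rfl | hne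
  · simp
  rcases Xᶜ.eq_empty_or_nonempty with hc | hcne
  · rw [Finset.compl_eq_empty_iff] at hc
    rw [hc, htotal]
  by_cases h1 : G.ConnectedOn (X : Set G.V)
  · by_cases h2 : G.ConnectedOn (↑(Xᶜ) : Set G.V)
    · exact hbond X hne hcne h1 h2 hX
    · obtain ⟨Y, Z, ⟨y, hy⟩, ⟨z, hz⟩, hdisj, hYZ, hsep⟩ :=
        G.exists_separation_of_not_connectedOn h2
      have hmem : ∀ w, w ∉ X ↔ w ∈ Y ∨ w ∈ Z := by
        intro w
        rw [← Finset.mem_compl, ← hYZ, Finset.mem_union]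
      have hnot : ∀ w, w ∈ Y → w ∉ Z := fun w h h' => Finset.disjoint_left.1 hdisj h h'
      obtain ⟨x, hx⟩ := hne
      have hxY : x ∉ Y := fun h => (hmem x).2 (Or.inl h) hx
      have hxZ : x ∉ Z := fun h => (hmem x).2 (Or.inr h) hx
      obtain ⟨e, he, he'⟩ := G.exists_edge_entering hconn (X := Yᶜ) (a := y) (b := x)
        (by simpa using hy) (by simpa using hxY)
      obtain ⟨e₂, he₂, he₂'⟩ := G.exists_edge_entering hconn (X := Zᶜ) (a := z) (b := x)
        (by simpa using hz) (by simpa using hxZ)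
      rw [Finset.mem_compl] at he he' he₂ he₂'
      have hY := key Yᶜ (by
        intro e
        have := hmem (G.tail e)
        have := hmem (G.head e)
        have := hsep e
        simp only [Finset.mem_compl]
        grind) ⟨e₂, by
          have := hmem (G.tail e₂)
          have := hmem (G.head e₂)
          have := hsep e₂
          have := hnot (G.tail e₂)
          simp only [Finset.mem_compl]
          grind⟩
      have hZ := key Zᶜ (by
        intro e
        have := hmem (G.tail e)
        have := hmem (G.head e)
        have := hsep e
        simp only [Finset.mem_compl]
        grind) ⟨e, by
          have := hmem (G.tail e)
          have := hmem (G.head e)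
          have := hsep e
          have := hnot (G.tail e)
          simp only [Finset.mem_compl]
          grind⟩
      have e1 := Finset.sum_add_sum_compl Y c
      have e2 := Finset.sum_add_sum_compl Z c
      have e3 := Finset.sum_add_sum_compl X c
      rw [← hYZ, Finset.sum_union hdisj] at e3
      linarith
  · obtain ⟨Y, Z, ⟨y, hy⟩, ⟨z, hz⟩, hdisj, hYZ, hsep⟩ :=
      G.exists_separation_of_not_connectedOn h1
    have hmem : ∀ w, w ∈ X ↔ w ∈ Y ∨ w ∈ Z := by
      intro w
      rw [← hYZ, Finset.mem_union]
    have hnot : ∀ w, w ∈ Y → w ∉ Z := fun w h h' => Finset.disjoint_left.1 hdisj h h'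
    obtain ⟨x, hx⟩ := hcne
    rw [Finset.mem_compl] at hx
    have hxY : x ∉ Y := fun h => hx ((hmem x).2 (Or.inl h))
    have hxZ : x ∉ Z := fun h => hx ((hmem x).2 (Or.inr h))
    obtain ⟨e, he, he'⟩ := G.exists_edge_entering hconn hxY hy
    obtain ⟨e₂, he₂, he₂'⟩ := G.exists_edge_entering hconn hxZ hz
    rw [← hYZ, Finset.sum_union hdisj]
    refine add_nonneg (key Y ?_ ⟨e₂, ?_⟩) (key Z ?_ ⟨e, ?_⟩)
    · intro e
      have := hmem (G.tail e)
      have := hmem (G.head e)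
      have := hsep e
      grind
    · have := hmem (G.tail e₂)
      have := hmem (G.head e₂)
      have := hsep e₂
      have := hnot (G.head e₂)
      grind
    · intro e
      have := hmem (G.tail e)
      have := hmem (G.head e)
      have := hsep e
      grind
    · have := hmem (G.tail e)
      have := hmem (G.head e)
      have := hsep e
      have := hnot (G.head e)
      grind

/-- The images under `d*` of the 1-cochains that are nonnegative on `D`. -/
def dstarNonnegOn (A : Type) [AddCommGroup A] [LinearOrder A] [IsOrderedAddMonoid A]
    (G : OrGraph) (D : Set G.EO) : AddSubmonoid (G.V → A) where
  carrier := {c | ∃ η : G.EO → A, G.IsC1 η ∧ (∀ e ∈ D, 0 ≤ η e) ∧ G.dstar η = c}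
  zero_mem' := ⟨0, fun e => by simp, fun e _ => by simp, by funext v; simp [dstar]⟩
  add_mem' := by
    rintro _ _ ⟨η, h1, h2, rfl⟩ ⟨θ, h3, h4, rfl⟩
    refine ⟨η + θ, fun e => ?_, fun e he => add_nonneg (h2 e he) (h4 e he), ?_⟩
    · simp only [Pi.add_apply, h1 e, h3 e, neg_add]
    · funext v
      simp [dstar, Finset.sum_add_distrib]

variable {A : Type} [AddCommGroup A] [LinearOrder A] [IsOrderedAddMonoid A]

theorem single_sub_single_mem_dstarNonnegOn (G : OrGraph) {D : Set G.EO} (e : G.EO)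
    (he : G.rev e ∉ D) (t : A) (ht : 0 ≤ t) :
    Pi.single (G.head e) t - Pi.single (G.tail e) t ∈ G.dstarNonnegOn A D := by
  have hrev : ∀ f, G.rev f = e ↔ f = G.rev e := fun f =>
    ⟨fun h => by rw [← h, G.rev_rev], fun h => by rw [h, G.rev_rev]⟩
  refine ⟨Pi.single e t - Pi.single (G.rev e) t, ?_, ?_, ?_⟩
  · intro f
    have h2 : G.rev f = G.rev e ↔ f = e :=
      ⟨fun h => by rw [← G.rev_rev f, h, G.rev_rev], fun h => by rw [h]⟩
    simp only [Pi.sub_apply, Pi.single_apply, hrev, h2, neg_sub]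
  · intro f hf
    have hfe : f ≠ G.rev e := fun h => he (h ▸ hf)
    simp only [Pi.sub_apply, Pi.single_apply, hfe, if_false, sub_zero]
    split_ifs
    exacts [ht, le_refl 0]
  · funext v
    simp only [dstar, Pi.sub_apply, Finset.sum_sub_distrib, Pi.single_apply,
      Finset.sum_ite_eq', Finset.mem_filter, Finset.mem_univ, true_and, G.head_rev,
      eq_comm (a := v)]

/-- Feasibility of the transport problem whose edges in `D` may only be used forwards. -/
theorem exists_lift_of_sum_nonneg (G : OrGraph) {D : Set G.EO} (hD : G.IsCAC D)
    (c : G.V → A) (htotal : ∑ v, c v = 0)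
    (hcut : ∀ X : Finset G.V, (∀ e, G.tail e ∉ X → G.head e ∈ X → e ∈ D) →
      0 ≤ ∑ v ∈ X, c v) :
    ∃ η : G.EO → A, G.IsC1 η ∧ (∀ e ∈ D, 0 ≤ η e) ∧ G.dstar η = c := by
  obtain ⟨r, rfl⟩ := hD
  refine mem_addSubmonoid_of_sum_upper_nonneg
    (G.dstarNonnegOn A {e | r (G.tail e) < r (G.head e)})
    (Relation.ReflTransGen fun a b =>
      ∃ e, G.tail e = a ∧ G.head e = b ∧ r (G.tail e) ≤ r (G.head e))
    (fun _ => .refl) (fun _ _ _ => .trans) ?_ Finset.univ c (by simp) htotal ?_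
  · intro u v huv t ht
    induction huv with
    | refl => simp
    | @tail b w _ hbw ih =>
      obtain ⟨e, rfl, rfl, her⟩ := hbw
      have := G.single_sub_single_mem_dstarNonnegOn
        (D := {e | r (G.tail e) < r (G.head e)}) e
        (by simpa [G.tail_rev, G.head_rev] using her) t ht
      simpa using add_mem this ih
  · intro Y _ hY
    refine hcut Y fun e ht hh => ?_
    by_contra hlt
    refine ht (hY _ hh _ (Finset.mem_univ _) (.single ⟨G.rev e, G.tail_rev e, G.head_rev e, ?_⟩))
    rw [G.tail_rev, G.head_rev]
    exact not_lt.1 hlt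

end OrGraph

/-- an element of the cut space pairing nonnegatively with all bond
elements with positive support in a coherent acyclic orientation `D` lifts to a
1-cochain nonnegative on `D` with the same image under `d*`; integrally if the
element is in the cut lattice. -/
theorem lift_nonneg_on_CAC (G : OrGraph) (hconn : G.Connected)
    (D : Set G.EO) (hD : G.IsCAC D)
    (φ : G.EO → ℝ) (hφ : φ ∈ G.cutSpace)
    (hpos : ∀ β : G.EO → ℝ, G.IsBond β → G.suppPlus β ⊆ D →
      0 ≤ (1 / 2) * ∑ e : G.EO, φ e * β e) :
    (∃ η : G.EO → ℝ, G.IsC1 η ∧ (∀ e ∈ D, 0 ≤ η e) ∧ G.dstar η = G.dstar φ) ∧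
    ((∃ f : G.V → ℤ, φ = G.d fun v => (f v : ℝ)) →
      ∃ η : G.EO → ℤ, G.IsC1 η ∧ (∀ e ∈ D, 0 ≤ η e) ∧
        G.dstar (fun e => (η e : ℝ)) = G.dstar φ) := by
  have hC1 : G.IsC1 φ := by
    obtain ⟨f, rfl⟩ := hφ
    exact G.isC1_d f
  have htotal := G.sum_univ_dstar hC1
  have hcut : ∀ X : Finset G.V, (∀ e, G.tail e ∉ X → G.head e ∈ X → e ∈ D) →
      0 ≤ ∑ v ∈ X, G.dstar φ v := by
    refine G.sum_nonneg_of_bonds hconn D _ htotal fun X h1 h2 h3 h4 hX => ?_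
    rw [← G.pairing_d_indicator hC1]
    refine hpos _ ⟨X, h1, h2, h3, h4, rfl⟩ fun e he => ?_
    simp only [OrGraph.suppPlus, OrGraph.d, Set.mem_ofPred_eq] at he
    by_cases hh : G.head e ∈ X <;> by_cases ht : G.tail e ∈ X <;> simp [hh, ht] at he
    · exact hX e ht hh
    · exact absurd he (by norm_num)
  refine ⟨G.exists_lift_of_sum_nonneg hD _ htotal hcut, ?_⟩
  rintro ⟨f, rfl⟩
  have hcast : ∀ (g : G.EO → ℤ) (v : G.V),
      G.dstar (fun e => (g e : ℝ)) v = ((G.dstar g v : ℤ) : ℝ) := by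
    intro g v
    simp [OrGraph.dstar]
  have hd : (G.d fun v => (f v : ℝ)) = fun e => ((G.d f e : ℤ) : ℝ) := by
    funext e
    simp [OrGraph.d]
  rw [hd] at htotal hcut ⊢
  simp only [hcast] at htotal hcut
  obtain ⟨η, h1, h2, h3⟩ := G.exists_lift_of_sum_nonneg hD (G.dstar (G.d f))
    (by exact_mod_cast htotal) (fun X hX => by exact_mod_cast hcut X hX)
  refine ⟨η, h1, h2, ?_⟩
  funext v
  rw [hcast, hcast, h3]
end

section
/- Let G=(V,E) be a finite loopless graph (not necessarily connected) and let D ⊆ 𝔼 be an orientation of a subset of the edges (for each edge, at most one of its two orientations belongs to D). Let h ∈ C^0(G,ℝ) with ∑_{v∈V} h(v) = 0. Then the following are equivalent: (1) for every subset X ⊆ V such that every oriented edge with tail in V−X and head in X belongs to D, one has h(X) := ∑_{v∈X} h(v) ≥ 0; (2) there exists η ∈ C^1(G,ℝ) with d*(η) = h and η(e) ≥ 0 for all e ∈ D. Moreover, if h takes integer values, then in (2) one may take η ∈ C^1(G,ℤ). -/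
open scoped Classical

namespace OrGraph

variable (G : OrGraph)

/-- Every oriented edge entering `X` lies in `D`. -/
def EntersIn (D : Set G.EO) (X : Finset G.V) : Prop :=
  ∀ e, G.tail e ∉ X → G.head e ∈ X → e ∈ D

/-- Some oriented edge goes from `u` to `v` whose reverse is not in `D`; a cochain that is
nonnegative on `D` may be increased freely along such an edge. -/
def Pushable (D : Set G.EO) (u v : G.V) : Prop :=
  ∃ e, G.tail e = u ∧ G.head e = v ∧ G.rev e ∉ D

variable {G} {D : Set G.EO}

theorem EntersIn.union {X Y : Finset G.V} (hX : G.EntersIn D X) (hY : G.EntersIn D Y) :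
    G.EntersIn D (X ∪ Y) := by
  intro e ht hh
  simp only [Finset.mem_union, not_or] at ht hh
  exact hh.elim (hX e ht.1) (hY e ht.2)

theorem EntersIn.inter {X Y : Finset G.V} (hX : G.EntersIn D X) (hY : G.EntersIn D Y) :
    G.EntersIn D (X ∩ Y) := by
  intro e ht hh
  simp only [Finset.mem_inter] at ht hh
  by_cases h : G.tail e ∈ X
  · exact hY e (fun h' => ht ⟨h, h'⟩) hh.2
  · exact hX e h hh.1

theorem EntersIn.mem_of_reflTransGen {X : Finset G.V} (hX : G.EntersIn D X) {u v : G.V}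
    (huv : Relation.ReflTransGen (G.Pushable D) u v) (hu : u ∈ X) : v ∈ X := by
  induction huv with
  | refl => exact hu
  | tail _ hbc ih =>
    obtain ⟨e, rfl, rfl, he⟩ := hbc
    by_contra hv
    exact he (hX (G.rev e) (by rwa [G.tail_rev]) (by rwa [G.head_rev]))

theorem entersIn_reachable (D : Set G.EO) (u : G.V) :
    G.EntersIn D (Finset.univ.filter (Relation.ReflTransGen (G.Pushable D) u)) := by
  intro e ht hh
  simp only [Finset.mem_filter, Finset.mem_univ, true_and] at ht hh
  by_contra he
  exact ht (hh.tail ⟨G.rev e, G.tail_rev e, G.head_rev e, by rwa [G.rev_rev]⟩)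

theorem sum_nonneg_of_dstar {η : G.EO → ℝ} (hη : G.IsC1 η) (hD : ∀ e ∈ D, 0 ≤ η e)
    {X : Finset G.V} (hX : G.EntersIn D X) : 0 ≤ ∑ v ∈ X, G.dstar η v := by
  have h1 : ∑ v ∈ X, G.dstar η v = ∑ e with G.head e ∈ X, η e := by
    unfold dstar
    rw [← Finset.sum_fiberwise_of_maps_to (s := Finset.univ.filter (fun e => G.head e ∈ X))
      (t := X) (g := G.head) (by simp)]
    refine Finset.sum_congr rfl fun v hv => Finset.sum_congr ?_ fun _ _ => rfl
    ext e
    simp only [Finset.mem_filter, Finset.mem_univ, true_and]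
    exact ⟨fun h => ⟨h ▸ hv, h⟩, fun h => h.2⟩
  rw [h1, ← Finset.sum_filter_add_sum_filter_not _ (fun e => G.tail e ∈ X)]
  have h2 : ∑ e ∈ (Finset.univ.filter (fun e => G.head e ∈ X)).filter
      (fun e => G.tail e ∈ X), η e = 0 := by
    refine Finset.sum_involution (fun e _ => G.rev e) ?_ ?_ ?_ ?_
    · intro e _
      rw [hη e, add_neg_cancel]
    · intro e _ _
      exact G.rev_ne e
    · intro e he
      simp only [Finset.mem_filter, Finset.mem_univ, true_and] at he ⊢
      rw [G.head_rev, G.tail_rev]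
      exact he.symm
    · intro e _
      exact G.rev_rev e
  rw [h2, zero_add]
  refine Finset.sum_nonneg fun e he => ?_
  simp only [Finset.mem_filter, Finset.mem_univ, true_and] at he
  exact hD e (hX e he.2 he.1)

section OrderedGroup

variable {A : Type} [AddCommGroup A]

theorem IsC1.add {η θ : G.EO → A} (hη : G.IsC1 η) (hθ : G.IsC1 θ) : G.IsC1 (η + θ) := by
  intro e
  rw [Pi.add_apply, Pi.add_apply, hη e, hθ e, neg_add]

theorem dstar_add (η θ : G.EO → A) : G.dstar (η + θ) = G.dstar η + G.dstar θ := by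
  funext v
  simp [dstar, Finset.sum_add_distrib]

/-- The number of nonzero values of `h` plus the number of non-tight sets. -/
noncomputable def slackCount (D : Set G.EO) (h : G.V → A) : ℕ :=
  (Finset.univ.filter (fun X => G.EntersIn D X ∧ ∑ w ∈ X, h w ≠ 0)).card +
    (Finset.univ.filter (fun v => h v ≠ 0)).card

theorem slackCount_lt {h k : G.V → A}
    (hset : ∀ X, G.EntersIn D X → ∑ w ∈ X, h w = 0 → ∑ w ∈ X, k w = 0)
    (hvert : ∀ w, h w = 0 → k w = 0)
    (hstrict : (∃ w, h w ≠ 0 ∧ k w = 0) ∨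
      ∃ X, G.EntersIn D X ∧ ∑ w ∈ X, h w ≠ 0 ∧ ∑ w ∈ X, k w = 0) :
    slackCount D k < slackCount D h := by
  have hsub₁ : Finset.univ.filter (fun X => G.EntersIn D X ∧ ∑ w ∈ X, k w ≠ 0) ⊆
      Finset.univ.filter (fun X => G.EntersIn D X ∧ ∑ w ∈ X, h w ≠ 0) :=
    Finset.monotone_filter_right _ fun X _ hX => ⟨hX.1, fun h0 => hX.2 (hset X hX.1 h0)⟩
  have hsub₂ : Finset.univ.filter (fun w => k w ≠ 0) ⊆ Finset.univ.filter (fun w => h w ≠ 0) :=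
    Finset.monotone_filter_right _ fun w _ hw h0 => hw (hvert w h0)
  rcases hstrict with ⟨w, hw, kw⟩ | ⟨X, hX, hw, kw⟩
  · exact add_lt_add_of_le_of_lt (Finset.card_le_card hsub₁) (Finset.card_lt_card
      ((Finset.ssubset_iff_of_subset hsub₂).2 ⟨w, by simpa using hw, by simpa using kw⟩))
  · exact add_lt_add_of_lt_of_le (Finset.card_lt_card
      ((Finset.ssubset_iff_of_subset hsub₁).2 ⟨X, by simpa [hX] using hw, by simp [kw]⟩))
      (Finset.card_le_card hsub₂)

theorem sum_sub_single_sub_single (h : G.V → A) (u v : G.V) (ε : A) (X : Finset G.V) :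
    ∑ w ∈ X, (h - (Pi.single v ε - Pi.single u ε) : G.V → A) w =
      ∑ w ∈ X, h w - ((if v ∈ X then ε else 0) - (if u ∈ X then ε else 0)) := by
  simp only [Pi.sub_apply, Finset.sum_sub_distrib, Finset.sum_pi_single']

variable [LinearOrder A]

theorem exists_dstar_eq_of_pushable {u v : G.V} (huv : G.Pushable D u v) {ε : A} (hε : 0 ≤ ε) :
    ∃ η : G.EO → A, G.IsC1 η ∧ G.dstar η = Pi.single v ε - Pi.single u ε ∧
      ∀ e ∈ D, 0 ≤ η e := by
  obtain ⟨e, rfl, rfl, he⟩ := huv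
  refine ⟨Pi.single e ε - Pi.single (G.rev e) ε, ?_, ?_, ?_⟩
  · intro f
    have h1 : G.rev f = e ↔ f = G.rev e :=
      ⟨fun h => by rw [← h, G.rev_rev], fun h => by rw [h, G.rev_rev]⟩
    have h2 : G.rev f = G.rev e ↔ f = e :=
      ⟨fun h => by rw [← G.rev_rev f, h, G.rev_rev], fun h => by rw [h]⟩
    simp only [Pi.sub_apply, Pi.single_apply, h1, h2, neg_sub]
  · funext w
    simp only [dstar, Pi.sub_apply, Finset.sum_sub_distrib, Pi.single_apply, Finset.sum_ite_eq',
      Finset.mem_filter, Finset.mem_univ, true_and, G.head_rev, eq_comm (a := w)]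
  · intro f hf
    have : f ≠ G.rev e := fun h => he (h ▸ hf)
    simp only [Pi.sub_apply, Pi.single_apply, this, if_false, sub_zero]
    split_ifs <;> simp [hε]

variable [IsOrderedAddMonoid A]

theorem exists_dstar_eq_of_reflTransGen {u v : G.V}
    (huv : Relation.ReflTransGen (G.Pushable D) u v) {ε : A} (hε : 0 ≤ ε) :
    ∃ η : G.EO → A, G.IsC1 η ∧ G.dstar η = Pi.single v ε - Pi.single u ε ∧
      ∀ e ∈ D, 0 ≤ η e := by
  induction huv with
  | refl => exact ⟨0, fun e => by simp, by funext w; simp [dstar], fun e _ => le_rfl⟩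
  | tail _ hbc ih =>
    obtain ⟨η, h1, h2, h3⟩ := ih
    obtain ⟨θ, k1, k2, k3⟩ := exists_dstar_eq_of_pushable hbc hε
    refine ⟨η + θ, h1.add k1, ?_, fun e he => add_nonneg (h3 e he) (k3 e he)⟩
    rw [dstar_add, h2, k2]
    abel

/-- If `h u < 0`, then some vertex `v` with `h v > 0` is reachable from `u` and is separated
from `u` by no tight set. -/
theorem exists_pos_reachable {h : G.V → A}
    (hcut : ∀ X, G.EntersIn D X → 0 ≤ ∑ v ∈ X, h v) {u : G.V} (hu : h u < 0) :
    ∃ v, Relation.ReflTransGen (G.Pushable D) u v ∧ 0 < h v ∧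
      ∀ X, G.EntersIn D X → v ∈ X → u ∉ X → 0 < ∑ w ∈ X, h w := by
  set T : Finset (Finset G.V) :=
    Finset.univ.filter (fun X => G.EntersIn D X ∧ u ∉ X ∧ ∑ w ∈ X, h w = 0) with hT
  set Y := T.sup id with hY
  have hYp : G.EntersIn D Y ∧ u ∉ Y ∧ ∑ w ∈ Y, h w = 0 := by
    refine Finset.sup_induction (p := fun X => G.EntersIn D X ∧ u ∉ X ∧ ∑ w ∈ X, h w = 0)
      ⟨fun e _ hh => by simp at hh, by simp, by simp⟩ ?_ ?_
    · rintro X ⟨hX, huX, hX0⟩ Z ⟨hZ, huZ, hZ0⟩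
      refine ⟨hX.union hZ, by simp [huX, huZ], le_antisymm ?_ (hcut _ (hX.union hZ))⟩
      have hui := Finset.sum_union_inter (s₁ := X) (s₂ := Z) (f := h)
      rw [hX0, hZ0, add_zero] at hui
      have hi := hcut _ (hX.inter hZ)
      exact (le_add_of_nonneg_right hi).trans hui.le
    · intro X hX
      simpa [hT] using hX
  set C := Finset.univ.filter (Relation.ReflTransGen (G.Pushable D) u) with hC
  have hCY : 0 ≤ ∑ w ∈ C \ Y, h w := by
    have := hcut _ ((entersIn_reachable D u).union hYp.1)
    rwa [← Finset.sdiff_union_self_eq_union, Finset.sum_union Finset.sdiff_disjoint, hYp.2.2,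
      add_zero] at this
  have huC : u ∈ C \ Y := by
    simp only [Finset.mem_sdiff, hC, Finset.mem_filter, Finset.mem_univ, true_and]
    exact ⟨Relation.ReflTransGen.refl, hYp.2.1⟩
  obtain ⟨v, hv, hv0⟩ : ∃ v ∈ C \ Y, 0 < h v := by
    by_contra! hneg
    exact (Finset.sum_neg' hneg ⟨u, huC, hu⟩).not_ge hCY
  simp only [Finset.mem_sdiff, hC, Finset.mem_filter, Finset.mem_univ, true_and] at hv
  refine ⟨v, hv.1, hv0, fun X hX hvX huX => (hcut X hX).lt_of_ne' fun h0 => hv.2 ?_⟩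
  have hXT : X ∈ T := by simp [hT, hX, huX, h0]
  exact Finset.le_sup (f := id) hXT hvX

theorem exists_push {h : G.V → A} (hcut : ∀ X, G.EntersIn D X → 0 ≤ ∑ v ∈ X, h v)
    {u : G.V} (hu : h u < 0) :
    ∃ (v : G.V) (ε : A), Relation.ReflTransGen (G.Pushable D) u v ∧ 0 ≤ ε ∧
      (∀ X, G.EntersIn D X →
        0 ≤ ∑ w ∈ X, (h - (Pi.single v ε - Pi.single u ε) : G.V → A) w) ∧
      slackCount D (h - (Pi.single v ε - Pi.single u ε)) < slackCount D h := by
  obtain ⟨v, huv, hv, hsep⟩ := exists_pos_reachable hcut hu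
  have hne : u ≠ v := fun e => (hu.trans (e ▸ hv)).false
  set F : Finset (Finset G.V) :=
    Finset.univ.filter (fun X => G.EntersIn D X ∧ v ∈ X ∧ u ∉ X) with hF
  set S : Finset A := insert (-h u) (insert (h v) (F.image fun X => ∑ w ∈ X, h w)) with hS
  have hSne : S.Nonempty := ⟨_, Finset.mem_insert_self _ _⟩
  set ε := S.min' hSne with hε
  have hmem : ε ∈ S := S.min'_mem hSne
  have hpos : ∀ a ∈ S, 0 < a := by
    intro a ha
    simp only [hS, hF, Finset.mem_insert, Finset.mem_image, Finset.mem_filter, Finset.mem_univ,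
      true_and] at ha
    rcases ha with rfl | rfl | ⟨X, ⟨hX, hvX, huX⟩, rfl⟩
    · exact neg_pos.2 hu
    · exact hv
    · exact hsep X hX hvX huX
  have hle : ∀ X, G.EntersIn D X → v ∈ X → u ∉ X → ε ≤ ∑ w ∈ X, h w := by
    intro X hX hvX huX
    refine S.min'_le _ ?_
    simp only [hS, Finset.mem_insert, Finset.mem_image]
    exact Or.inr (Or.inr ⟨X, by simp [hF, hX, hvX, huX], rfl⟩)
  have hsum : ∀ X, G.EntersIn D X →
      ∑ w ∈ X, (h - (Pi.single v ε - Pi.single u ε) : G.V → A) w =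
        ∑ w ∈ X, h w - if v ∈ X ∧ u ∉ X then ε else 0 := by
    intro X hX
    rw [sum_sub_single_sub_single]
    by_cases huX : u ∈ X
    · simp [huX, hX.mem_of_reflTransGen huv huX]
    · simp [huX]
  have hval : ∀ w, (h - (Pi.single v ε - Pi.single u ε) : G.V → A) w =
      if w = v then h v - ε else if w = u then h u + ε else h w := by
    intro w
    by_cases hwv : w = v
    · subst hwv; simp [hne.symm]
    · by_cases hwu : w = u
      · subst hwu; simp [hne]
      · simp [hwv, hwu]
  refine ⟨v, ε, huv, (hpos ε hmem).le, ?_, slackCount_lt ?_ ?_ ?_⟩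
  · intro X hX
    rw [hsum X hX]
    split_ifs with hvu
    · exact sub_nonneg.2 (hle X hX hvu.1 hvu.2)
    · simpa using hcut X hX
  · intro X hX h0
    rw [hsum X hX, h0, if_neg, sub_zero]
    rintro ⟨hvX, huX⟩
    exact (hsep X hX hvX huX).ne' h0
  · intro w h0
    have hwv : w ≠ v := by rintro rfl; exact hv.ne' h0
    have hwu : w ≠ u := by rintro rfl; exact hu.ne h0
    rw [hval, if_neg hwv, if_neg hwu, h0]
  · simp only [hS, hF, Finset.mem_insert, Finset.mem_image, Finset.mem_filter, Finset.mem_univ,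
      true_and] at hmem
    rcases hmem with he | he | ⟨X, ⟨hX, hvX, huX⟩, he⟩
    · exact Or.inl ⟨u, hu.ne, by rw [hval, if_neg hne, if_pos rfl, he, add_neg_cancel]⟩
    · exact Or.inl ⟨v, hv.ne', by rw [hval, if_pos rfl, he, sub_self]⟩
    · exact Or.inr ⟨X, hX, (hsep X hX hvX huX).ne',
        by rw [hsum X hX, if_pos ⟨hvX, huX⟩, he, sub_self]⟩

theorem exists_dstar_eq_of_cut_nonneg (h : G.V → A) (hsum : ∑ v, h v = 0)
    (hcut : ∀ X, G.EntersIn D X → 0 ≤ ∑ v ∈ X, h v) :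
    ∃ η : G.EO → A, G.IsC1 η ∧ G.dstar η = h ∧ ∀ e ∈ D, 0 ≤ η e := by
  induction hn : slackCount D h using Nat.strong_induction_on generalizing h with
  | _ n ih =>
    subst hn
    by_cases hneg : ∃ u, h u < 0
    · obtain ⟨u, hu⟩ := hneg
      obtain ⟨v, ε, huv, hε, hcut', hlt⟩ := exists_push hcut hu
      obtain ⟨η, h1, h2, h3⟩ := ih _ hlt _
        (by rw [sum_sub_single_sub_single]; simp [hsum]) hcut' rfl
      obtain ⟨θ, k1, k2, k3⟩ := exists_dstar_eq_of_reflTransGen huv hε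
      refine ⟨η + θ, h1.add k1, ?_, fun e he => add_nonneg (h3 e he) (k3 e he)⟩
      rw [dstar_add, h2, k2, sub_add_cancel]
    · push Not at hneg
      have h0 : h = 0 := by
        funext v
        exact (Finset.sum_eq_zero_iff_of_nonneg fun v _ => hneg v).1 hsum v (Finset.mem_univ v)
      exact ⟨0, fun e => by simp, by funext w; simp [dstar, h0], fun e _ => le_rfl⟩

end OrderedGroup

end OrGraph

/-- for a (not necessarily connected) finite loopless graph, an
orientation `D` of a subset of edges and `h` summing to zero, `h(X) ≥ 0` for
every cut `X` with `𝔼(V-X,X) ⊆ D` iff `h = d*(η)` for some `η` nonnegative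
on `D`; integrally when `h` is integer valued. -/
theorem exists_nonneg_preimage_dstar (G : OrGraph)
    (D : Set G.EO) (hD : ∀ e ∈ D, G.rev e ∉ D)
    (h : G.V → ℝ) (hsum : ∑ v : G.V, h v = 0) :
    ((∀ X : Finset G.V, (∀ e, G.tail e ∉ X → G.head e ∈ X → e ∈ D) →
        0 ≤ ∑ v ∈ X, h v) ↔
      (∃ η : G.EO → ℝ, G.IsC1 η ∧ G.dstar η = h ∧ ∀ e ∈ D, 0 ≤ η e)) ∧
    ((∀ v, ∃ z : ℤ, h v = (z : ℝ)) →
      (∀ X : Finset G.V, (∀ e, G.tail e ∉ X → G.head e ∈ X → e ∈ D) →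
        0 ≤ ∑ v ∈ X, h v) →
      ∃ η : G.EO → ℤ, G.IsC1 η ∧ G.dstar (fun e => (η e : ℝ)) = h ∧
        ∀ e ∈ D, 0 ≤ η e) := by
  refine ⟨⟨fun hcut => OrGraph.exists_dstar_eq_of_cut_nonneg h hsum hcut, ?_⟩, ?_⟩
  · rintro ⟨η, hη, rfl, hpos⟩ X hX
    exact OrGraph.sum_nonneg_of_dstar hη hpos hX
  · intro hint hcut
    choose z hz using hint
    obtain rfl : h = fun v => (z v : ℝ) := funext hz
    beta_reduce at hsum hcut
    obtain ⟨η, h1, h2, h3⟩ := OrGraph.exists_dstar_eq_of_cut_nonneg (D := D) z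
      (by exact_mod_cast hsum) (fun X hX => by exact_mod_cast hcut X hX)
    refine ⟨η, h1, ?_, h3⟩
    funext v
    rw [← h2]
    simp [OrGraph.dstar]
end

section
/- Let D be an acyclic orientation of all edges of G and let κ be a field. Let α be the κ-algebra homomorphism from the polynomial ring κ[x_e : e ∈ D] to the monoid algebra κ[C^1(G,ℚ)] (the AddMonoidAlgebra of the additive group C^1(G,ℚ) over κ) sending each variable x_e to the basis element corresponding to π(χ_e − χ_ē). Then the kernel of α is the ideal generated by the binomials ∏_{e ∈ γ ∩ D} x_e − ∏_{e ∈ D, ē ∈ γ} x_e, one for each oriented cycle γ in G (the first product over the oriented edges of γ lying in D, the second over the oriented edges e ∈ D whose reversal lies in γ). -/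
open scoped Classical

namespace OrGraph

/-- The additive group `C^1(G,ℚ)` of rational 1-cochains, as an additive
subgroup of `𝔼 → ℚ`. -/
def C1Q (G : OrGraph) : AddSubgroup (G.EO → ℚ) where
  carrier := {g | ∀ e, g (G.rev e) = - g e}
  add_mem' := by
    intro a b ha hb e
    simp only [Set.mem_setOf_eq] at ha hb
    simp only [Pi.add_apply, ha e, hb e]
    ring
  zero_mem' := by intro e; simp
  neg_mem' := by
    intro a ha e
    simp only [Set.mem_setOf_eq] at ha
    simp only [Pi.neg_apply, ha e]

end OrGraph

section MonomialMap

variable {σ κ A : Type*} [Field κ] [AddCommGroup A] (v : σ → A)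

theorem aeval_single_monomial (a : σ →₀ ℕ) :
    MvPolynomial.aeval (fun i => (AddMonoidAlgebra.single (v i) (1 : κ) : AddMonoidAlgebra κ A))
      (MvPolynomial.monomial a (1 : κ)) =
      AddMonoidAlgebra.single (a.sum fun i n => n • v i) 1 := by
  induction a using Finsupp.induction_linear with
  | zero =>
    rw [MvPolynomial.monomial_zero', MvPolynomial.C_1, map_one, Finsupp.sum_zero_index]
    rfl
  | add f g hf hg =>
    have h : (MvPolynomial.monomial (f + g) (1 : κ)) =
        MvPolynomial.monomial f 1 * MvPolynomial.monomial g 1 := by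
      simp [MvPolynomial.monomial_mul]
    rw [h, map_mul, hf, hg, AddMonoidAlgebra.single_mul_single, one_mul,
      Finsupp.sum_add_index' (by simp) (fun _ _ _ => add_smul _ _ _)]
  | single i n =>
    simp [MvPolynomial.aeval_monomial, AddMonoidAlgebra.single_pow]

/-- An ideal containing all pure binomials in the kernel of a monomial map contains the kernel. -/
theorem mem_of_aeval_single_eq_zero (I : Ideal (MvPolynomial σ κ))
    (hI : ∀ a b : σ →₀ ℕ, (a.sum fun i n => n • v i) = (b.sum fun i n => n • v i) →
      MvPolynomial.monomial a (1 : κ) - MvPolynomial.monomial b 1 ∈ I)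
    (p : MvPolynomial σ κ)
    (hp : MvPolynomial.aeval
      (fun i => (AddMonoidAlgebra.single (v i) (1 : κ) : AddMonoidAlgebra κ A)) p = 0) :
    p ∈ I := by
  let wt : (σ →₀ ℕ) → A := fun a => a.sum fun i n => n • v i
  let L : AddMonoidAlgebra κ A →ₗ[κ] MvPolynomial σ κ ⧸ I :=
    (Finsupp.linearCombination κ fun x =>
      Ideal.Quotient.mk I (MvPolynomial.monomial (Function.invFun wt x) 1)) ∘ₗ
      (AddMonoidAlgebra.coeffLinearEquiv κ).toLinearMap
  have key : L ∘ₗ (MvPolynomial.aeval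
      (fun i => (AddMonoidAlgebra.single (v i) (1 : κ) : AddMonoidAlgebra κ A))).toLinearMap =
      (Ideal.Quotient.mkₐ κ I).toLinearMap := by
    apply MvPolynomial.linearMap_ext
    intro a
    ext
    simp only [LinearMap.comp_apply, AlgHom.toLinearMap_apply, aeval_single_monomial]
    simp only [L, LinearMap.comp_apply, LinearEquiv.coe_coe,
      AddMonoidAlgebra.coeffLinearEquiv_apply, AddMonoidAlgebra.coeff_single,
      Finsupp.linearCombination_single, one_smul, Ideal.Quotient.mkₐ_eq_mk]
    exact Ideal.Quotient.eq.2 (hI _ _ (Function.invFun_eq (f := wt) ⟨a, rfl⟩))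
  have h := LinearMap.congr_fun key p
  rw [LinearMap.comp_apply, AlgHom.toLinearMap_apply, hp, map_zero] at h
  exact Ideal.Quotient.eq_zero_iff_mem.1 h.symm

end MonomialMap

theorem exists_mem_periodicPts {α : Type*} [Finite α] [Nonempty α] (f : α → α) :
    ∃ x, x ∈ Function.periodicPts f := by
  inhabit α
  obtain ⟨m, n, hmn, h⟩ :=
    Finite.exists_ne_map_eq_of_infinite fun n : ℕ => f^[n] (default : α)
  wlog hlt : m < n generalizing m n
  · exact this n m hmn.symm h.symm (by omega)
  refine ⟨f^[m] default, n - m, by omega, ?_⟩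
  change f^[n - m] (f^[m] default) = f^[m] default
  rw [← Function.iterate_add_apply, Nat.sub_add_cancel hlt.le]
  exact h.symm

namespace OrGraph

variable {G : OrGraph}

theorem d_rev_s5 (f : G.V → ℚ) (e : G.EO) : G.d f (G.rev e) = - G.d f e := by
  simp [d, G.head_rev, G.tail_rev]

theorem sum_chi_mul_d (f : G.V → ℚ) (e : G.EO) :
    ∑ e', G.chi ℚ e e' * G.d f e' = 2 * G.d f e := by
  have h : ∀ e', G.chi ℚ e e' * G.d f e' =
      (if e' = e then G.d f e' else 0) + (if e' = G.rev e then - G.d f e' else 0) := by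
    intro e'
    have := G.rev_ne e
    unfold chi
    by_cases h1 : e' = e
    · subst h1
      simp [this.symm]
    · by_cases h2 : e' = G.rev e <;> simp [h1, h2, this]
  rw [Finset.sum_congr rfl fun e' _ => h e', Finset.sum_add_distrib]
  simp [d_rev_s5]
  ring

/-- A finite set of oriented edges in which every edge has a successor contains a cycle. -/
theorem exists_isCycle_of_forall_exists_tail_eq_head (S : Set G.EO) (hne : S.Nonempty)
    (hrev : ∀ e ∈ S, G.rev e ∉ S) (hS : ∀ e ∈ S, ∃ e' ∈ S, G.tail e' = G.head e) :
    ∃ γ, G.IsCycle γ ∧ ∀ e ∈ γ, e ∈ S := by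
  choose f hfS hf using hS
  let s : S → S := fun e => ⟨f e e.2, hfS e e.2⟩
  have hs : ∀ e : S, G.tail (s e) = G.head e := fun e => hf e e.2
  have : Nonempty S := hne.to_subtype
  obtain ⟨x, hx⟩ := exists_mem_periodicPts s
  have hpos := Function.minimalPeriod_pos_of_mem_periodicPts hx
  refine ⟨(List.range (Function.minimalPeriod s x)).map fun i => (s^[i] x : G.EO),
    ⟨?_, ?_, ?_⟩, ?_⟩
  · simpa using hpos.ne'
  · rintro ⟨i, hi⟩
    simp only [List.get_eq_getElem, List.getElem_map, List.getElem_range, List.length_map,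
      List.length_range]
    rw [Function.iterate_mod_minimalPeriod_eq, Function.iterate_succ_apply', hs]
  · rintro ⟨i, hi⟩ ⟨j, hj⟩ hij
    simp only [List.length_map, List.length_range] at hi hj
    simp only [List.get_eq_getElem, List.getElem_map, List.getElem_range]
    refine ⟨fun h => hij ?_, fun h => ?_⟩
    · have := Function.iterate_injOn_Iio_minimalPeriod (f := s) (x := x) hi hj (Subtype.ext h)
      exact Fin.ext this
    · exact hrev _ (s^[j] x).2 (h ▸ (s^[i] x).2)
  · intro e he
    obtain ⟨i, -, rfl⟩ := List.mem_map.1 he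
    exact (s^[i] x).2

/-- The support of a nonzero nonnegative circulation contains a cycle. -/
theorem exists_isCycle_of_circulation (w : G.EO → ℚ) (hw : ∀ e, 0 ≤ w e) (hne : ∃ e, 0 < w e)
    (hrev : ∀ e, 0 < w e → ¬ 0 < w (G.rev e))
    (hcirc : ∀ f : G.V → ℚ, ∑ e, w e * G.d f e = 0) :
    ∃ γ, G.IsCycle γ ∧ ∀ e ∈ γ, 0 < w e := by
  refine exists_isCycle_of_forall_exists_tail_eq_head {e | 0 < w e} hne hrev ?_
  intro e he
  by_contra! hno
  refine (hcirc fun v => if v = G.head e then 1 else 0).not_gt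
    (Finset.sum_pos' (fun e' _ => ?_) ⟨e, Finset.mem_univ _, ?_⟩)
  · rcases (hw e').eq_or_lt with h | h
    · simp [← h]
    · refine mul_nonneg h.le ?_
      simp only [d, if_neg (hno e' h), sub_zero]
      split_ifs <;> norm_num
  · refine mul_pos he ?_
    simp [d, if_neg (hno e he)]

theorem IsCycle.nodup {γ : List G.EO} (hγ : G.IsCycle γ) : γ.Nodup := by
  rw [List.nodup_iff_injective_get]
  intro i j h
  by_contra hij
  exact (hγ.2.2 i j hij).1 h

theorem IsCycle.sum_d {γ : List G.EO} (hγ : G.IsCycle γ) (f : G.V → ℚ) :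
    ∑ e ∈ γ.toFinset, G.d f e = 0 := by
  rw [List.sum_toFinset _ hγ.nodup, ← Fin.sum_univ_fun_getElem]
  let r : Fin γ.length → Fin γ.length := fun i => ⟨((i : ℕ) + 1) % γ.length, Nat.mod_lt _ i.pos⟩
  have hr : Function.Bijective r := by
    rw [← Finite.injective_iff_bijective]
    intro i j h
    have h1 : (i : ℕ) ≡ j [MOD γ.length] :=
      Nat.ModEq.add_right_cancel' 1 (Fin.ext_iff.1 h)
    exact Fin.ext (h1.eq_of_lt_of_lt i.2 j.2)
  simp only [d, Finset.sum_sub_distrib]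
  rw [← hr.sum_comp fun i => f (G.tail γ[(i : ℕ)]), sub_eq_zero]
  exact Finset.sum_congr rfl fun i _ => congrArg f (hγ.2.1 i)

theorem sum_compl_eq_sum_rev {D : Finset G.EO} (hD : ∀ e, e ∈ D ↔ G.rev e ∉ D)
    (g : G.EO → ℚ) : ∑ e ∈ Dᶜ, g e = ∑ e ∈ D, g (G.rev e) := by
  refine Finset.sum_bij' (fun e _ => G.rev e) (fun e _ => G.rev e) ?_ ?_ ?_ ?_ ?_
  · intro e he
    rw [hD, G.rev_rev]
    exact Finset.mem_compl.1 he
  · intro e he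
    exact Finset.mem_compl.2 ((hD e).1 he)
  all_goals simp [G.rev_rev]

theorem sum_eq_sum_orientation {D : Finset G.EO} (hD : ∀ e, e ∈ D ↔ G.rev e ∉ D)
    (g : G.EO → ℚ) : ∑ e, g e = ∑ e : {x // x ∈ D}, (g e + g (G.rev e)) := by
  rw [← Finset.sum_add_sum_compl D, sum_compl_eq_sum_rev hD, ← Finset.sum_add_distrib,
    ← Finset.sum_coe_sort]

theorem IsCycle.sum_d_pos_eq_sum_d_neg {γ : List G.EO} (hγ : G.IsCycle γ) {D : Finset G.EO}
    (hD : ∀ e, e ∈ D ↔ G.rev e ∉ D) (f : G.V → ℚ) :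
    (∑ e : {x // x ∈ D}, if (e : G.EO) ∈ γ then G.d f e else 0) =
      ∑ e : {x // x ∈ D}, if G.rev (e : G.EO) ∈ γ then G.d f e else 0 := by
  have h := hγ.sum_d f
  have h' : ∑ e, (if e ∈ γ then G.d f e else 0) = 0 := by
    rw [← Finset.sum_filter]
    refine Eq.trans (Finset.sum_congr (by ext; simp) fun _ _ => rfl) h
  rw [sum_eq_sum_orientation hD, Finset.sum_add_distrib] at h'
  rw [eq_neg_of_add_eq_zero_left h', ← Finset.sum_neg_distrib]
  refine Finset.sum_congr rfl fun e _ => ?_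
  split_ifs <;> simp [d_rev_s5]

section Projection

variable {D : Finset G.EO} {pr : G.EO → G.C1Q}

theorem coe_sum_smul_apply (a : {x // x ∈ D} →₀ ℕ) (e' : G.EO) :
    ((a.sum fun e n => n • pr (e : G.EO) : G.C1Q) : G.EO → ℚ) e' =
      ∑ e : {x // x ∈ D}, (a e : ℚ) * (pr e : G.EO → ℚ) e' := by
  rw [Finsupp.sum_fintype _ _ (by simp)]
  simp [Finset.sum_apply]

theorem sum_sum_smul_mul_d
    (hprOrth : ∀ e, ∀ f : G.V → ℚ,
      ∑ e' : G.EO, (G.chi ℚ e e' - (pr e : G.EO → ℚ) e') * G.d f e' = 0)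
    (a : {x // x ∈ D} →₀ ℕ) (f : G.V → ℚ) :
    ∑ e', ((a.sum fun e n => n • pr (e : G.EO) : G.C1Q) : G.EO → ℚ) e' * G.d f e' =
      2 * ∑ e : {x // x ∈ D}, (a e : ℚ) * G.d f e := by
  simp only [coe_sum_smul_apply, Finset.sum_mul]
  rw [Finset.sum_comm, Finset.mul_sum]
  refine Finset.sum_congr rfl fun e _ => ?_
  have h := hprOrth e f
  simp only [sub_mul, Finset.sum_sub_distrib, sum_chi_mul_d] at h
  simp only [mul_assoc, ← Finset.mul_sum]
  linear_combination -(a e : ℚ) * h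

theorem exists_sum_smul_eq_d (hprF : ∀ e, ∃ f : G.V → ℚ, (pr e : G.EO → ℚ) = G.d f)
    (a : {x // x ∈ D} →₀ ℕ) :
    ∃ f : G.V → ℚ, ∀ e',
      ((a.sum fun e n => n • pr (e : G.EO) : G.C1Q) : G.EO → ℚ) e' = G.d f e' := by
  choose F hF using hprF
  refine ⟨fun v => ∑ e : {x // x ∈ D}, (a e : ℚ) * F e v, fun e' => ?_⟩
  rw [coe_sum_smul_apply]
  simp only [hF, d, mul_sub, Finset.sum_sub_distrib]

/-- Two exponents have the same image under the projection to the cut space if and only if their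
difference is a circulation. -/
theorem sum_smul_eq_iff (hprF : ∀ e, ∃ f : G.V → ℚ, (pr e : G.EO → ℚ) = G.d f)
    (hprOrth : ∀ e, ∀ f : G.V → ℚ,
      ∑ e' : G.EO, (G.chi ℚ e e' - (pr e : G.EO → ℚ) e') * G.d f e' = 0)
    (a b : {x // x ∈ D} →₀ ℕ) :
    (a.sum fun e n => n • pr (e : G.EO)) = (b.sum fun e n => n • pr (e : G.EO)) ↔
      ∀ f : G.V → ℚ, ∑ e : {x // x ∈ D}, (a e : ℚ) * G.d f e =
        ∑ e : {x // x ∈ D}, (b e : ℚ) * G.d f e := by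
  refine ⟨fun h f => ?_, fun h => ?_⟩
  · have h1 := sum_sum_smul_mul_d hprOrth a f
    rw [h, sum_sum_smul_mul_d hprOrth b f] at h1
    linarith
  · obtain ⟨fa, ha⟩ := exists_sum_smul_eq_d hprF a
    obtain ⟨fb, hb⟩ := exists_sum_smul_eq_d hprF b
    have h1 := sum_sum_smul_mul_d hprOrth a (fa - fb)
    rw [h, ← sum_sum_smul_mul_d hprOrth b (fa - fb), ← sub_eq_zero,
      ← Finset.sum_sub_distrib] at h1
    have hd : ∀ e, G.d (fa - fb) e = G.d fa e - G.d fb e := fun e => by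
      simp only [d, Pi.sub_apply]
      ring
    simp only [ha, hb, hd, ← sub_mul] at h1
    rw [Finset.sum_eq_zero_iff_of_nonneg fun e _ => mul_self_nonneg _] at h1
    ext e
    rw [ha, hb]
    exact sub_eq_zero.1 (mul_self_eq_zero.1 (h1 e (Finset.mem_univ e)))

end Projection

/-- The exponent vector of the product of the variables indexed by `p`. -/
noncomputable def indicatorExponent {σ : Type*} [Fintype σ] (p : σ → Prop) : σ →₀ ℕ :=
  ∑ e ∈ Finset.univ.filter p, Finsupp.single e 1

theorem indicatorExponent_apply {σ : Type*} [Fintype σ] (p : σ → Prop) (e : σ) :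
    indicatorExponent p e = if p e then 1 else 0 := by
  simp [indicatorExponent, Finsupp.finsetSum_apply, Finsupp.single_apply]

theorem monomial_indicatorExponent {σ κ : Type*} [Fintype σ] [Field κ] (p : σ → Prop)
    [DecidablePred p] :
    MvPolynomial.monomial (indicatorExponent p) (1 : κ) =
      ∏ e ∈ Finset.univ.filter p, MvPolynomial.X e := by
  rw [indicatorExponent, MvPolynomial.monomial_sum_one]
  exact Finset.prod_congr (by ext; simp) fun _ _ => rfl

theorem IsCycle.sum_smul_indicatorExponent_eq {D : Finset G.EO}
    (hD : ∀ e : G.EO, e ∈ D ↔ G.rev e ∉ D) {pr : G.EO → G.C1Q}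
    (hprF : ∀ e, ∃ f : G.V → ℚ, (pr e : G.EO → ℚ) = G.d f)
    (hprOrth : ∀ e, ∀ f : G.V → ℚ,
      ∑ e' : G.EO, (G.chi ℚ e e' - (pr e : G.EO → ℚ) e') * G.d f e' = 0)
    {γ : List G.EO} (hγ : G.IsCycle γ) :
    ((indicatorExponent fun e : {x // x ∈ D} => (e : G.EO) ∈ γ).sum
        fun e n => n • pr (e : G.EO)) =
      (indicatorExponent fun e : {x // x ∈ D} => G.rev (e : G.EO) ∈ γ).sum
        fun e n => n • pr (e : G.EO) := by
  rw [sum_smul_eq_iff hprF hprOrth]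
  intro f
  simpa [indicatorExponent_apply] using hγ.sum_d_pos_eq_sum_d_neg hD f

/-- If `a - b` is a nonzero circulation and `a`, `b` have disjoint supports, there is a cycle whose
positive part is bounded by `a` and whose negative part is bounded by `b`. -/
theorem exists_isCycle_le {D : Finset G.EO} (hD : ∀ e : G.EO, e ∈ D ↔ G.rev e ∉ D)
    (a b : {x // x ∈ D} →₀ ℕ) (hab : ∀ e, a e = 0 ∨ b e = 0) (hne : a ≠ 0 ∨ b ≠ 0)
    (h : ∀ f : G.V → ℚ, ∑ e : {x // x ∈ D}, (a e : ℚ) * G.d f e =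
        ∑ e : {x // x ∈ D}, (b e : ℚ) * G.d f e) :
    ∃ γ, G.IsCycle γ ∧
      (indicatorExponent fun e : {x // x ∈ D} => (e : G.EO) ∈ γ) ≤ a ∧
      (indicatorExponent fun e : {x // x ∈ D} => G.rev (e : G.EO) ∈ γ) ≤ b := by
  let w : G.EO → ℚ := fun e =>
    if he : e ∈ D then (a ⟨e, he⟩ : ℚ)
    else (b ⟨G.rev e, by simpa [G.rev_rev] using (hD (G.rev e)).2 (by rwa [G.rev_rev])⟩ : ℚ)
  have hwa : ∀ e : {x // x ∈ D}, w e = a e := fun e => by simp [w]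
  have hwb : ∀ e : {x // x ∈ D}, w (G.rev e) = b e := fun e => by
    simp [w, (hD e).1 e.2, G.rev_rev]
  have hw : ∀ e, 0 ≤ w e := fun e => by
    simp only [w]
    split_ifs <;> positivity
  have hexcl : ∀ e : {x // x ∈ D}, 0 < w e → ¬ 0 < w (G.rev e) := fun e => by
    rw [hwa, hwb]
    rcases hab e with h0 | h0 <;> simp [h0]
  have hpos : ∃ e, 0 < w e := by
    rcases hne with hne | hne <;> obtain ⟨e, he⟩ := Finsupp.ne_iff.1 hne
    · exact ⟨e, by rw [hwa]; exact_mod_cast Nat.pos_of_ne_zero he⟩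
    · exact ⟨G.rev e, by rw [hwb]; exact_mod_cast Nat.pos_of_ne_zero he⟩
  have hrev : ∀ e, 0 < w e → ¬ 0 < w (G.rev e) := by
    intro e h1 h2
    by_cases he : e ∈ D
    · exact hexcl ⟨e, he⟩ h1 h2
    · have he' : G.rev e ∈ D := by
        by_contra h3
        exact he ((hD e).2 h3)
      exact hexcl ⟨G.rev e, he'⟩ h2 (by simpa [G.rev_rev] using h1)
  have hcirc : ∀ f : G.V → ℚ, ∑ e, w e * G.d f e = 0 := by
    intro f
    rw [sum_eq_sum_orientation hD, Finset.sum_add_distrib]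
    simp only [hwa, hwb, d_rev_s5, mul_neg, Finset.sum_neg_distrib, h f, add_neg_cancel]
  obtain ⟨γ, hγ, hγpos⟩ := exists_isCycle_of_circulation w hw hpos hrev hcirc
  refine ⟨γ, hγ, fun e => ?_, fun e => ?_⟩
  all_goals
    rw [indicatorExponent_apply]
    split_ifs with he
    · have := hγpos _ he
      simp only [hwa, hwb, Nat.cast_pos] at this
      exact this
    · exact Nat.zero_le _

/-- The ideal generated by the binomials of the cycles of `G`. -/
noncomputable def cycleIdeal (G : OrGraph) (κ : Type) [Field κ] (D : Finset G.EO) :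
    Ideal (MvPolynomial {x // x ∈ D} κ) :=
  Ideal.span { P : MvPolynomial {x // x ∈ D} κ |
    ∃ γ : List G.EO, G.IsCycle γ ∧
      P = (∏ e ∈ Finset.univ.filter (fun e : {x // x ∈ D} => (e : G.EO) ∈ γ),
            MvPolynomial.X e) -
          (∏ e ∈ Finset.univ.filter (fun e : {x // x ∈ D} => G.rev (e : G.EO) ∈ γ),
            MvPolynomial.X e) }

theorem monomial_sub_monomial_mem_cycleIdeal (κ : Type) [Field κ] {D : Finset G.EO}
    (hD : ∀ e : G.EO, e ∈ D ↔ G.rev e ∉ D) (a b : {x // x ∈ D} →₀ ℕ)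
    (h : ∀ f : G.V → ℚ, ∑ e : {x // x ∈ D}, (a e : ℚ) * G.d f e =
        ∑ e : {x // x ∈ D}, (b e : ℚ) * G.d f e) :
    MvPolynomial.monomial a (1 : κ) - MvPolynomial.monomial b 1 ∈ cycleIdeal G κ D := by
  induction hn : a.degree + b.degree using Nat.strong_induction_on generalizing a b with
  | _ n ih =>
    have step : ∀ p q a' b' : {x // x ∈ D} →₀ ℕ, a = p + a' → b = q + b' → (p ≠ 0 ∨ q ≠ 0) →
        (∀ f : G.V → ℚ, ∑ e : {x // x ∈ D}, (p e : ℚ) * G.d f e =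
          ∑ e : {x // x ∈ D}, (q e : ℚ) * G.d f e) →
        MvPolynomial.monomial p (1 : κ) - MvPolynomial.monomial q 1 ∈ cycleIdeal G κ D →
        MvPolynomial.monomial a (1 : κ) - MvPolynomial.monomial b 1 ∈ cycleIdeal G κ D := by
      rintro p q a' b' rfl rfl hpq hcirc hmem
      have hlt : a'.degree + b'.degree < n := by
        have : 0 < p.degree + q.degree := by
          rcases hpq with hp | hq
          · have := Finsupp.degree_eq_zero_iff p |>.not.2 hp
            omega
          · have := Finsupp.degree_eq_zero_iff q |>.not.2 hq
            omega
        simp only [map_add] at hn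
        omega
      have hrest := ih _ hlt a' b' (fun f => by
        have h1 := h f
        simp only [Finsupp.add_apply, Nat.cast_add, add_mul, Finset.sum_add_distrib] at h1
        linarith [hcirc f]) rfl
      have hmul : ∀ s t : {x // x ∈ D} →₀ ℕ, MvPolynomial.monomial (s + t) (1 : κ) =
          MvPolynomial.monomial s 1 * MvPolynomial.monomial t 1 := fun s t => by
        simp [MvPolynomial.monomial_mul]
      have heq : MvPolynomial.monomial (p + a') (1 : κ) - MvPolynomial.monomial (q + b') 1 =
          MvPolynomial.monomial a' 1 *
            (MvPolynomial.monomial p 1 - MvPolynomial.monomial q 1) +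
          MvPolynomial.monomial q 1 *
            (MvPolynomial.monomial a' 1 - MvPolynomial.monomial b' 1) := by
        rw [hmul, hmul]
        ring
      rw [heq]
      exact add_mem (Ideal.mul_mem_left _ _ hmem) (Ideal.mul_mem_left _ _ hrest)
    by_cases hab : ∀ e, a e = 0 ∨ b e = 0
    · by_cases hne : a ≠ 0 ∨ b ≠ 0
      · obtain ⟨γ, hγ, ha, hb⟩ := exists_isCycle_le hD a b hab hne h
        refine step _ _ _ _ (add_tsub_cancel_of_le ha).symm (add_tsub_cancel_of_le hb).symm ?_ ?_
          (Ideal.subset_span ⟨γ, hγ, by simp only [monomial_indicatorExponent]⟩)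
        · obtain ⟨e, he⟩ := List.exists_mem_of_ne_nil γ hγ.1
          by_cases heD : e ∈ D
          · refine Or.inl (Finsupp.ne_iff.2 ⟨⟨e, heD⟩, ?_⟩)
            simp [indicatorExponent_apply, he]
          · have heD' : G.rev e ∈ D := by
              by_contra h3
              exact heD ((hD e).2 h3)
            refine Or.inr (Finsupp.ne_iff.2 ⟨⟨G.rev e, heD'⟩, ?_⟩)
            simp [indicatorExponent_apply, he, G.rev_rev]
        · intro f
          simpa [indicatorExponent_apply] using hγ.sum_d_pos_eq_sum_d_neg hD f
      · push Not at hne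
        simp [hne.1, hne.2]
    · push Not at hab
      obtain ⟨e, hae, hbe⟩ := hab
      have hle : ∀ c : {x // x ∈ D} →₀ ℕ, c e ≠ 0 → Finsupp.single e 1 ≤ c := fun c hc =>
        Finsupp.single_le_iff.2 (Nat.one_le_iff_ne_zero.2 hc)
      exact step _ _ _ _ (add_tsub_cancel_of_le (hle a hae)).symm
        (add_tsub_cancel_of_le (hle b hbe)).symm (Or.inl (by simp)) (fun _ => rfl) (by simp)

end OrGraph

/-- for an acyclic orientation `D` of all edges of `G`, the kernel
of the map `κ[x_e : e ∈ D] → κ[C^1(G,ℚ)]`, `x_e ↦ π(χ_e - χ_ē)` (with `π` the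
orthogonal projection onto the cut space), is generated by the binomials
attached to the oriented cycles of `G`. -/
theorem toric_ideal_of_acyclic_orientation (G : OrGraph) (hconn : G.Connected)
    (κ : Type) [Field κ]
    (D : Finset G.EO) (hD1 : ∀ e : G.EO, e ∈ D ↔ G.rev e ∉ D)
    (hD2 : ¬∃ γ : List G.EO, G.IsCycle γ ∧ ∀ e ∈ γ, e ∈ D)
    (pr : G.EO → G.C1Q)
    (hprF : ∀ e, ∃ f : G.V → ℚ, (pr e : G.EO → ℚ) = G.d f)
    (hprOrth : ∀ e, ∀ f : G.V → ℚ,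
      ∑ e' : G.EO, (G.chi ℚ e e' - (pr e : G.EO → ℚ) e') * G.d f e' = 0) :
    RingHom.ker (MvPolynomial.aeval
        (fun e : {x // x ∈ D} =>
          (AddMonoidAlgebra.single (pr (e : G.EO)) (1 : κ) :
            AddMonoidAlgebra κ G.C1Q)) :
        MvPolynomial {x // x ∈ D} κ →ₐ[κ] AddMonoidAlgebra κ G.C1Q) =
      Ideal.span { P : MvPolynomial {x // x ∈ D} κ |
        ∃ γ : List G.EO, G.IsCycle γ ∧
          P = (∏ e ∈ Finset.univ.filter (fun e : {x // x ∈ D} => (e : G.EO) ∈ γ),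
                MvPolynomial.X e) -
              (∏ e ∈ Finset.univ.filter (fun e : {x // x ∈ D} => G.rev (e : G.EO) ∈ γ),
                MvPolynomial.X e) } := by
  refine le_antisymm (fun p hp => ?_) ?_
  · refine mem_of_aeval_single_eq_zero (fun e : {x // x ∈ D} => pr (e : G.EO)) _
      (fun a b hab => ?_) p hp
    exact OrGraph.monomial_sub_monomial_mem_cycleIdeal κ hD1 a b
      ((OrGraph.sum_smul_eq_iff hprF hprOrth a b).1 hab)
  · refine Ideal.span_le.2 ?_
    rintro _ ⟨γ, hγ, rfl⟩
    rw [SetLike.mem_coe, RingHom.mem_ker, ← OrGraph.monomial_indicatorExponent,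
      ← OrGraph.monomial_indicatorExponent, map_sub,
      aeval_single_monomial (fun e : {x // x ∈ D} => pr (e : G.EO)),
      aeval_single_monomial (fun e : {x // x ∈ D} => pr (e : G.EO)),
      hγ.sum_smul_indicatorExponent_eq hD1 hprF hprOrth, sub_self]
end

section
/- Let f, h ∈ C^0(G,ℤ) and n, p ∈ ℕ. Let γ be an oriented cycle in G such that 𝔡^{𝔪,p}_h(e) ∈ ℤ for every e ∈ γ. Then there exists e₁ ∈ γ with 𝔡^{𝔪,n}_f(e₁) < 𝔡^{𝔪,p}_h(e₁) if and only if there exists e₂ ∈ γ with 𝔡^{𝔪,n}_f(e₂) > 𝔡^{𝔪,p}_h(e₂). -/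
open scoped Classical

theorem Int.floor_sub_floor_neg_lt_two_mul_iff (x : ℚ) (z : ℤ) :
    ⌊x⌋ - ⌊-x⌋ < 2 * z ↔ x < z := by
  rw [Int.floor_neg, ← Int.floor_lt]
  have h₁ := Int.floor_le_ceil x
  have h₂ := Int.ceil_le_floor_add_one x
  constructor
  · intro h
    omega
  · intro h
    have h₃ : ⌈x⌉ ≤ z := Int.ceil_le.2 (Int.floor_lt.1 h).le
    omega

theorem Int.two_mul_lt_floor_sub_floor_neg_iff (x : ℚ) (z : ℤ) :
    2 * z < ⌊x⌋ - ⌊-x⌋ ↔ z < x := by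
  have h := Int.floor_sub_floor_neg_lt_two_mul_iff (-x) (-z)
  rw [neg_neg, Int.cast_neg, neg_lt_neg_iff] at h
  rw [← h]
  omega

theorem Int.eq_of_floor_sub_floor_neg_eq_two_mul {x : ℚ} {z : ℤ}
    (h : ⌊x⌋ - ⌊-x⌋ = 2 * z) : x = z :=
  le_antisymm
    (not_lt.1 fun hx => ((Int.two_mul_lt_floor_sub_floor_neg_iff x z).2 hx).ne' h)
    (not_lt.1 fun hx => ((Int.floor_sub_floor_neg_lt_two_mul_iff x z).2 hx).ne h)

namespace OrGraph

variable (G : OrGraph)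

/-- The rational slope whose rounding is `𝔡^{𝔪,n}_f(e)`. -/
def slope (ℓ : G.EO → ℕ) (m : G.EO → ℤ) (n : ℕ) (f : G.V → ℤ) (e : G.EO) : ℚ :=
  ((f (G.head e) : ℚ) - (f (G.tail e) : ℚ) + (n : ℚ) * (m e : ℚ)) /
    ((n : ℚ) * (ℓ e : ℚ))

section Slope

variable {G} {ℓ : G.EO → ℕ} {m : G.EO → ℤ}

theorem slope_rev (hℓsym : ∀ e, ℓ (G.rev e) = ℓ e) (hm : G.IsC1 m)
    (n : ℕ) (f : G.V → ℤ) (e : G.EO) :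
    G.slope ℓ m n f (G.rev e) = -G.slope ℓ m n f e := by
  rw [slope, slope, G.head_rev, G.tail_rev, hℓsym, hm e, ← neg_div]
  push_cast
  ring

theorem dd_eq_floor_slope (hℓsym : ∀ e, ℓ (G.rev e) = ℓ e) (hm : G.IsC1 m)
    (n : ℕ) (f : G.V → ℤ) (e : G.EO) :
    G.dd ℓ m n f e =
      ((⌊G.slope ℓ m n f e⌋ - ⌊-G.slope ℓ m n f e⌋ : ℤ) : ℚ) / 2 := by
  rw [← slope_rev hℓsym hm, Int.cast_sub]
  rfl

theorem dd_lt_intCast_iff (hℓsym : ∀ e, ℓ (G.rev e) = ℓ e) (hm : G.IsC1 m)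
    (n : ℕ) (f : G.V → ℤ) (e : G.EO) (z : ℤ) :
    G.dd ℓ m n f e < z ↔ G.slope ℓ m n f e < z := by
  rw [dd_eq_floor_slope hℓsym hm, ← Int.floor_sub_floor_neg_lt_two_mul_iff (G.slope ℓ m n f e),
    div_lt_iff₀ two_pos, mul_comm]
  exact_mod_cast Iff.rfl

theorem intCast_lt_dd_iff (hℓsym : ∀ e, ℓ (G.rev e) = ℓ e) (hm : G.IsC1 m)
    (n : ℕ) (f : G.V → ℤ) (e : G.EO) (z : ℤ) :
    z < G.dd ℓ m n f e ↔ z < G.slope ℓ m n f e := by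
  rw [dd_eq_floor_slope hℓsym hm, ← Int.two_mul_lt_floor_sub_floor_neg_iff (G.slope ℓ m n f e),
    lt_div_iff₀ two_pos, mul_comm]
  exact_mod_cast Iff.rfl

theorem slope_eq_of_dd_eq_intCast (hℓsym : ∀ e, ℓ (G.rev e) = ℓ e) (hm : G.IsC1 m)
    {n : ℕ} {f : G.V → ℤ} {e : G.EO} {z : ℤ} (h : G.dd ℓ m n f e = z) :
    G.slope ℓ m n f e = z := by
  apply Int.eq_of_floor_sub_floor_neg_eq_two_mul
  rw [dd_eq_floor_slope hℓsym hm, div_eq_iff two_ne_zero, mul_comm] at h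
  exact_mod_cast h

theorem length_mul_slope_sub_slope (hℓpos : ∀ e, 0 < ℓ e) {n p : ℕ} (hn : 0 < n) (hp : 0 < p)
    (f h : G.V → ℤ) (e : G.EO) :
    (ℓ e : ℚ) * (G.slope ℓ m n f e - G.slope ℓ m p h e) =
      G.d (fun v => (f v : ℚ) / n - (h v : ℚ) / p) e := by
  have hℓ : (ℓ e : ℚ) ≠ 0 := by exact_mod_cast (hℓpos e).ne'
  have hn' : (n : ℚ) ≠ 0 := by exact_mod_cast hn.ne'
  have hp' : (p : ℚ) ≠ 0 := by exact_mod_cast hp.ne'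
  unfold slope d
  field_simp
  ring

end Slope

variable {G}

theorem IsCycle.sum_d_eq_zero {A : Type} [AddCommGroup A] {γ : List G.EO} (hγ : G.IsCycle γ)
    (g : G.V → A) : ∑ i : Fin γ.length, G.d g (γ.get i) = 0 := by
  let next : Fin γ.length → Fin γ.length := fun i =>
    ⟨((i : ℕ) + 1) % γ.length, Nat.mod_lt _ i.pos⟩
  have hnext : Function.Bijective next := by
    refine Finite.injective_iff_bijective.1 fun i j hij => Fin.ext ?_
    have h : (i : ℕ) + 1 ≡ j + 1 [MOD γ.length] := congrArg Fin.val hij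
    exact (Nat.ModEq.add_right_cancel' 1 h).eq_of_lt_of_lt i.isLt j.isLt
  have hsum := hnext.sum_comp fun i => g (G.tail (γ.get i))
  simp only [d, Finset.sum_sub_distrib]
  rw [← hsum, sub_eq_zero]
  exact Finset.sum_congr rfl fun i _ => congrArg g (hγ.2.1 i)

theorem IsCycle.exists_d_neg_iff_exists_d_pos {γ : List G.EO} (hγ : G.IsCycle γ) (g : G.V → ℚ) :
    (∃ e ∈ γ, G.d g e < 0) ↔ ∃ e ∈ γ, 0 < G.d g e := by
  have hsum := hγ.sum_d_eq_zero g
  simp only [List.mem_iff_get, exists_exists_eq_and]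
  constructor
  · rintro ⟨i, hi⟩
    obtain ⟨j, -, hj⟩ := Finset.exists_pos_of_sum_zero_of_exists_nonzero _ hsum
      ⟨i, Finset.mem_univ i, hi.ne⟩
    exact ⟨j, hj⟩
  · rintro ⟨i, hi⟩
    obtain ⟨j, -, hj⟩ := Finset.exists_pos_of_sum_zero_of_exists_nonzero
      (fun j => -G.d g (γ.get j)) (by rw [Finset.sum_neg_distrib, hsum, neg_zero])
      ⟨i, Finset.mem_univ i, neg_ne_zero.2 hi.ne'⟩
    exact ⟨j, neg_pos.1 hj⟩

end OrGraph

/-- on an oriented cycle along which `𝔡^{𝔪,p}_h` is integral,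
`𝔡^{𝔪,n}_f` is somewhere smaller than `𝔡^{𝔪,p}_h` iff it is somewhere bigger. -/
theorem dd_lt_iff_gt_on_cycle (G : OrGraph) (hconn : G.Connected)
    (ℓ : G.EO → ℕ) (hℓpos : ∀ e, 0 < ℓ e) (hℓsym : ∀ e, ℓ (G.rev e) = ℓ e)
    (m : G.EO → ℤ) (hm : G.IsC1 m)
    (f h : G.V → ℤ) (n p : ℕ) (hn : 0 < n) (hp : 0 < p)
    (γ : List G.EO) (hγ : G.IsCycle γ)
    (hint : ∀ e ∈ γ, ∃ z : ℤ, G.dd ℓ m p h e = (z : ℚ)) :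
    (∃ e₁ ∈ γ, G.dd ℓ m n f e₁ < G.dd ℓ m p h e₁) ↔
      (∃ e₂ ∈ γ, G.dd ℓ m p h e₂ < G.dd ℓ m n f e₂) := by
  let g : G.V → ℚ := fun v => (f v : ℚ) / n - (h v : ℚ) / p
  have hℓ (e : G.EO) : (0 : ℚ) < ℓ e := by exact_mod_cast hℓpos e
  have hlt : ∀ e ∈ γ, (G.dd ℓ m n f e < G.dd ℓ m p h e ↔ G.d g e < 0) := by
    intro e he
    obtain ⟨z, hz⟩ := hint e he
    rw [hz, OrGraph.dd_lt_intCast_iff hℓsym hm, ← OrGraph.slope_eq_of_dd_eq_intCast hℓsym hm hz,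
      ← OrGraph.length_mul_slope_sub_slope (m := m) hℓpos hn hp, ← smul_eq_mul,
      smul_neg_iff_of_pos_left (hℓ e), sub_neg]
  have hgt : ∀ e ∈ γ, (G.dd ℓ m p h e < G.dd ℓ m n f e ↔ 0 < G.d g e) := by
    intro e he
    obtain ⟨z, hz⟩ := hint e he
    rw [hz, OrGraph.intCast_lt_dd_iff hℓsym hm, ← OrGraph.slope_eq_of_dd_eq_intCast hℓsym hm hz,
      ← OrGraph.length_mul_slope_sub_slope (m := m) hℓpos hn hp, mul_pos_iff_of_pos_left (hℓ e),
      sub_pos]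
  have hcycle := hγ.exists_d_neg_iff_exists_d_pos g
  grind
end

section
/- Let f₁, f₂ ∈ C^0(G,ℤ) and n ∈ ℕ. If the difference 𝔡^{𝔪,n}_{f₂} − 𝔡^{𝔪,n}_{f₁} takes integer values and lies in the kernel of d* (i.e., it belongs to H^1(G,ℤ)), then 𝔡^{𝔪,n}_{f₂} = 𝔡^{𝔪,n}_{f₁}. -/
open scoped Classical

namespace OrGraph

variable (G : OrGraph)

/-- Reversing an edge negates `𝔡^{𝔪,n}_f`. -/
theorem dd_rev (ℓ : G.EO → ℕ) (m : G.EO → ℤ) (n : ℕ) (f : G.V → ℤ) (e : G.EO) :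
    G.dd ℓ m n f (G.rev e) = - G.dd ℓ m n f e := by
  simp only [dd, G.rev_rev]
  ring

/-- `𝔡^{𝔪,n}_f(e)` is monotone in the difference of `f` along `e`. -/
theorem dd_le_dd {ℓ : G.EO → ℕ} {m : G.EO → ℤ} {n : ℕ}
    {f₁ f₂ : G.V → ℤ} {e : G.EO} (h : G.d f₁ e ≤ G.d f₂ e) :
    G.dd ℓ m n f₁ e ≤ G.dd ℓ m n f₂ e := by
  have hq : (f₁ (G.head e) : ℚ) - f₁ (G.tail e) ≤ f₂ (G.head e) - f₂ (G.tail e) := by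
    simp only [d] at h
    exact_mod_cast h
  have h₁ : G.ddelta ℓ m n f₁ e ≤ G.ddelta ℓ m n f₂ e := by
    unfold ddelta
    gcongr
  have h₂ : G.ddelta ℓ m n f₂ (G.rev e) ≤ G.ddelta ℓ m n f₁ (G.rev e) := by
    unfold ddelta
    rw [G.head_rev, G.tail_rev]
    refine Int.floor_le_floor (div_le_div_of_nonneg_right ?_ (by positivity))
    linarith
  have h₁' : (G.ddelta ℓ m n f₁ e : ℚ) ≤ G.ddelta ℓ m n f₂ e := by exact_mod_cast h₁
  have h₂' : (G.ddelta ℓ m n f₂ (G.rev e) : ℚ) ≤ G.ddelta ℓ m n f₁ (G.rev e) := by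
    exact_mod_cast h₂
  unfold dd
  linarith

/-- A 1-cochain in the kernel of `d*` is orthogonal to every coboundary. -/
theorem sum_mul_d_eq_zero {A : Type} [CommRing A] {g : G.EO → A} (hg : G.IsC1 g)
    (hker : G.dstar g = 0) (h : G.V → A) : ∑ e, g e * G.d h e = 0 := by
  have hhead : ∑ e, g e * h (G.head e) = 0 := by
    rw [← Finset.sum_fiberwise Finset.univ G.head]
    refine Finset.sum_eq_zero fun v _ => ?_
    have hv : ∑ e with G.head e = v, g e = 0 := by
      simpa only [dstar, Pi.zero_apply] using congrFun hker v
    calc ∑ e with G.head e = v, g e * h (G.head e)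
        = ∑ e with G.head e = v, g e * h v :=
          Finset.sum_congr rfl fun e he => by rw [(Finset.mem_filter.mp he).2]
      _ = 0 := by rw [← Finset.sum_mul, hv, zero_mul]
  have htail : ∑ e, g e * h (G.tail e) = 0 := by
    have hrev : Function.Involutive G.rev := G.rev_rev
    rw [← Equiv.sum_comp hrev.toPerm]
    simp only [Function.Involutive.coe_toPerm, hg _, G.tail_rev, neg_mul,
      Finset.sum_neg_distrib, hhead, neg_zero]
  simp only [d, mul_sub, Finset.sum_sub_distrib, hhead, htail, sub_zero]

end OrGraph

/-- if `𝔡^{𝔪,n}_{f₂} - 𝔡^{𝔪,n}_{f₁}` is integer valued and lies in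
`H^1(G,ℤ) = ker d*`, then `𝔡^{𝔪,n}_{f₂} = 𝔡^{𝔪,n}_{f₁}`. -/
theorem dd_eq_of_diff_integral_in_ker (G : OrGraph) (hconn : G.Connected)
    (ℓ : G.EO → ℕ) (hℓpos : ∀ e, 0 < ℓ e) (hℓsym : ∀ e, ℓ (G.rev e) = ℓ e)
    (m : G.EO → ℤ) (hm : G.IsC1 m)
    (f₁ f₂ : G.V → ℤ) (n : ℕ) (hn : 0 < n)
    (hint : ∀ e, ∃ z : ℤ, G.dd ℓ m n f₂ e - G.dd ℓ m n f₁ e = (z : ℚ))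
    (hker : G.dstar (fun e => G.dd ℓ m n f₂ e - G.dd ℓ m n f₁ e) = 0) :
    ∀ e, G.dd ℓ m n f₂ e = G.dd ℓ m n f₁ e := by
  set g : G.EO → ℚ := fun e => G.dd ℓ m n f₂ e - G.dd ℓ m n f₁ e with hg
  have hgC1 : G.IsC1 g := fun e => by
    simp only [hg, G.dd_rev]
    ring
  set h : G.V → ℚ := fun v => f₂ v - f₁ v with hh
  have hd : ∀ e, G.d h e = ((G.d f₂ e - G.d f₁ e : ℤ) : ℚ) := fun e => by
    simp only [hh, OrGraph.d]
    push_cast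
    ring
  have hnonneg : ∀ e, 0 ≤ g e * G.d h e := fun e => by
    rw [hd]
    rcases le_total (G.d f₁ e) (G.d f₂ e) with hle | hle
    · exact mul_nonneg (sub_nonneg.mpr (G.dd_le_dd hle))
        (by exact_mod_cast sub_nonneg.mpr hle)
    · exact mul_nonneg_of_nonpos_of_nonpos (sub_nonpos.mpr (G.dd_le_dd hle))
        (by exact_mod_cast sub_nonpos.mpr hle)
  intro e
  have hzero : g e * G.d h e = 0 :=
    (Finset.sum_eq_zero_iff_of_nonneg fun e _ => hnonneg e).mp
      (G.sum_mul_d_eq_zero hgC1 hker h) e (Finset.mem_univ e)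
  rcases mul_eq_zero.mp hzero with hge | hde
  · exact sub_eq_zero.mp hge
  · have heq : G.d f₂ e = G.d f₁ e := by
      rw [hd] at hde
      exact sub_eq_zero.mp (by exact_mod_cast hde)
    exact le_antisymm (G.dd_le_dd heq.le) (G.dd_le_dd heq.ge)
end

section
/- Let n ∈ ℕ and f ∈ C^0(G,ℤ), and define g ∈ C^0(G,ℤ) by g(v) = ⌊f(v)/n⌋ for each v ∈ V. Then for every oriented edge e ∈ 𝔼: (1) if 𝔡^{𝔪,n}_f(e) ∈ ℤ, then 𝔡^𝔪_g(e) = 𝔡^{𝔪,n}_f(e); (2) if 𝔡^{𝔪,n}_f(e) ∉ ℤ, then |𝔡^𝔪_g(e) − 𝔡^{𝔪,n}_f(e)| ≤ 1/2. -/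
open scoped Classical

/-- Either `d` divides `x`, and `x / d` and `-x / d` are opposite, or `x` lies strictly between two
consecutive multiples of `d`, and `x / d + -x / d = -1`. -/
theorem Int.ediv_neg_ediv_cases {d : ℤ} (hd : 0 < d) (x : ℤ) :
    (∃ q, x = d * q ∧ x / d = q ∧ -x / d = -q) ∨
      ∃ q, d * q < x ∧ x < d * (q + 1) ∧ x / d = q ∧ -x / d = -q - 1 := by
  have h1 := Int.emod_add_mul_ediv x d
  have h2 := Int.emod_nonneg x hd.ne'
  have h3 := Int.emod_lt_of_pos x hd
  rcases h2.eq_or_lt with h | h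
  · refine Or.inl ⟨x / d, by linarith, rfl, ?_⟩
    rw [Int.ediv_eq_iff_of_pos hd]
    constructor <;> linarith
  · refine Or.inr ⟨x / d, by linarith, by linarith, rfl, ?_⟩
    rw [Int.ediv_eq_iff_of_pos hd]
    constructor <;> linarith

namespace OrGraph

/-- The numerator `f(head e) - f(tail e) + n 𝔪_e` in the definition of `ddelta`. -/
def ddeltaNum (G : OrGraph) (m : G.EO → ℤ) (n : ℕ) (f : G.V → ℤ) (e : G.EO) : ℤ :=
  f (G.head e) - f (G.tail e) + n * m e

theorem ddelta_eq_ediv (G : OrGraph) (ℓ : G.EO → ℕ) (m : G.EO → ℤ) (n : ℕ) (f : G.V → ℤ)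
    (e : G.EO) : G.ddelta ℓ m n f e = G.ddeltaNum m n f e / ((n : ℤ) * ℓ e) := by
  have h := Rat.floor_intCast_div_natCast (G.ddeltaNum m n f e) (n * ℓ e)
  push_cast [ddeltaNum] at h
  exact h

theorem ddeltaNum_rev (G : OrGraph) {m : G.EO → ℤ} (hm : G.IsC1 m) (n : ℕ) (f : G.V → ℤ)
    (e : G.EO) : G.ddeltaNum m n f (G.rev e) = -G.ddeltaNum m n f e := by
  simp only [ddeltaNum, G.head_rev, G.tail_rev, hm e]
  ring

/-- `dd` is the quotient `ddeltaNum / (n ℓ)` when this is an integer, and its floor plus `1 / 2`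
otherwise. -/
theorem dd_cases (G : OrGraph) {ℓ : G.EO → ℕ} (hpos : ∀ e, 0 < ℓ e)
    (hsym : ∀ e, ℓ (G.rev e) = ℓ e) {m : G.EO → ℤ} (hm : G.IsC1 m) {n : ℕ} (hn : 0 < n)
    (f : G.V → ℤ) (e : G.EO) :
    (∃ q : ℤ, G.ddeltaNum m n f e = n * ℓ e * q ∧ G.dd ℓ m n f e = q) ∨
      ∃ q : ℤ, n * ℓ e * q < G.ddeltaNum m n f e ∧ G.ddeltaNum m n f e < n * ℓ e * (q + 1) ∧
        G.dd ℓ m n f e = q + 1 / 2 := by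
  have hd : (0 : ℤ) < n * ℓ e := by
    have := hpos e
    positivity
  simp only [dd, ddelta_eq_ediv, G.ddeltaNum_rev hm, hsym]
  rcases Int.ediv_neg_ediv_cases hd (G.ddeltaNum m n f e) with
    ⟨q, h, h1, h2⟩ | ⟨q, h, h', h1, h2⟩
  · refine Or.inl ⟨q, h, ?_⟩
    rw [h1, h2]
    push_cast
    ring
  · refine Or.inr ⟨q, h, h', ?_⟩
    rw [h1, h2]
    push_cast
    ring

end OrGraph

/-- comparison of `𝔡^𝔪_g` and `𝔡^{𝔪,n}_f` when `g = ⌊f/n⌋`. -/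
theorem dd_floor_comparison (G : OrGraph) (hconn : G.Connected)
    (ℓ : G.EO → ℕ) (hℓpos : ∀ e, 0 < ℓ e) (hℓsym : ∀ e, ℓ (G.rev e) = ℓ e)
    (m : G.EO → ℤ) (hm : G.IsC1 m)
    (n : ℕ) (hn : 0 < n) (f g : G.V → ℤ)
    (hg : ∀ v, g v = ⌊(f v : ℚ) / (n : ℚ)⌋) :
    ∀ e : G.EO,
      ((∃ z : ℤ, G.dd ℓ m n f e = (z : ℚ)) → G.dd ℓ m 1 g e = G.dd ℓ m n f e) ∧
      (¬(∃ z : ℤ, G.dd ℓ m n f e = (z : ℚ)) →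
        |G.dd ℓ m 1 g e - G.dd ℓ m n f e| ≤ 1 / 2) := by
  intro e
  have hn' : (0 : ℤ) < n := by exact_mod_cast hn
  have hℓ' : (0 : ℤ) < ℓ e := by exact_mod_cast hℓpos e
  have hgdiv : ∀ v, n * g v ≤ f v ∧ f v < n * g v + n := fun v => by
    rw [hg v, Rat.floor_intCast_div_natCast]
    have h1 := Int.emod_add_mul_ediv (f v) n
    have h2 := Int.emod_nonneg (f v) hn'.ne'
    have h3 := Int.emod_lt_of_pos (f v) hn'
    constructor <;> linarith
  obtain ⟨hh1, hh2⟩ := hgdiv (G.head e)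
  obtain ⟨ht1, ht2⟩ := hgdiv (G.tail e)
  have hlow : n * (G.ddeltaNum m 1 g e - 1) < G.ddeltaNum m n f e := by
    simp only [OrGraph.ddeltaNum]
    push_cast
    linarith
  have hupp : G.ddeltaNum m n f e < n * (G.ddeltaNum m 1 g e + 1) := by
    simp only [OrGraph.ddeltaNum]
    push_cast
    linarith
  have key1 : ∀ k : ℤ, n * ℓ e * k ≤ G.ddeltaNum m n f e → ℓ e * k ≤ G.ddeltaNum m 1 g e :=
    fun k hk => Int.lt_add_one_iff.mp (lt_of_mul_lt_mul_left (by linarith) hn'.le)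
  have key2 : ∀ k : ℤ, G.ddeltaNum m n f e ≤ n * ℓ e * k → G.ddeltaNum m 1 g e ≤ ℓ e * k :=
    fun k hk => Int.sub_one_lt_iff.mp (lt_of_mul_lt_mul_left (by linarith) hn'.le)
  rcases G.dd_cases hℓpos hℓsym hm hn f e with ⟨q, h, hq⟩ | ⟨q, h1, h2, hq⟩
  · refine ⟨fun _ => ?_, fun hnot => absurd ⟨q, hq⟩ hnot⟩
    have hY := le_antisymm (key2 q h.le) (key1 q h.ge)
    rw [hq]
    rcases G.dd_cases hℓpos hℓsym hm one_pos g e with ⟨p, hp, hpq⟩ | ⟨p, hp1, hp2, -⟩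
    · rw [hpq]
      rw [hY, Nat.cast_one, one_mul] at hp
      exact_mod_cast (mul_left_cancel₀ hℓ'.ne' hp).symm
    · rw [hY, Nat.cast_one, one_mul] at hp1 hp2
      have := lt_of_mul_lt_mul_left hp1 hℓ'.le
      have := lt_of_mul_lt_mul_left hp2 hℓ'.le
      omega
  · refine ⟨fun ⟨z, hz⟩ => ?_, fun _ => ?_⟩
    · exfalso
      rw [hq] at hz
      have h : 2 * q + 1 = 2 * z := by
        have : (2 * q + 1 : ℚ) = 2 * z := by linarith
        exact_mod_cast this
      omega
    · have hY1 := key1 q h1.le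
      have hY2 := key2 (q + 1) h2.le
      rw [hq, abs_le]
      rcases G.dd_cases hℓpos hℓsym hm one_pos g e with ⟨p, hp, hpq⟩ | ⟨p, hp1, hp2, hpq⟩
      · rw [hpq]
        rw [hp, Nat.cast_one, one_mul] at hY1 hY2
        have hqp : (q : ℚ) ≤ p := by exact_mod_cast le_of_mul_le_mul_left hY1 hℓ'
        have hpq' : (p : ℚ) ≤ q + 1 := by exact_mod_cast le_of_mul_le_mul_left hY2 hℓ'
        constructor <;> linarith
      · rw [Nat.cast_one, one_mul] at hp1 hp2
        have h3 := lt_of_mul_lt_mul_left (hY1.trans_lt hp2) hℓ'.le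
        have h4 := lt_of_mul_lt_mul_left (hp1.trans_le hY2) hℓ'.le
        obtain rfl : p = q := by omega
        rw [hpq]
        norm_num
end

section
/- For every f ∈ C^0(G,ℤ) there exists h ∈ C^0(G,ℤ) such that the spanning subgraph G^𝔪_h is connected, every edge of G^𝔪_f is an edge of G^𝔪_h, and |𝔡^𝔪_h(e) − 𝔡^𝔪_f(e)| ≤ 1/2 for every oriented edge e ∈ 𝔼. -/
open scoped Classical

namespace OrGraph

variable {G : OrGraph}

theorem ddelta_one (ℓ : G.EO → ℕ) (m : G.EO → ℤ) (f : G.V → ℤ) (e : G.EO) :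
    G.ddelta ℓ m 1 f e = (f (G.head e) - f (G.tail e) + m e) / (ℓ e : ℤ) := by
  rw [← Rat.floor_intCast_div_natCast]
  simp [ddelta]

theorem ddelta_one_rev {ℓ : G.EO → ℕ} (hℓsym : ∀ e, ℓ (G.rev e) = ℓ e)
    {m : G.EO → ℤ} (hm : G.IsC1 m) (f : G.V → ℤ) (e : G.EO) :
    G.ddelta ℓ m 1 f (G.rev e) = (-(f (G.head e) - f (G.tail e) + m e)) / (ℓ e : ℤ) := by
  rw [ddelta_one, hℓsym, hm, G.head_rev, G.tail_rev]
  congr 1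
  ring

theorem _root_.Int.ediv_add_neg_ediv (a : ℤ) {L : ℤ} (hL : 0 < L) :
    (L ∣ a ∧ a / L + (-a) / L = 0) ∨ (¬ L ∣ a ∧ a / L + (-a) / L = -1) := by
  by_cases h : L ∣ a
  · left
    exact ⟨h, by rw [Int.neg_ediv_of_dvd h]; ring⟩
  · right
    refine ⟨h, ?_⟩
    rw [Int.neg_ediv, if_neg h, Int.sign_eq_one_of_pos hL]
    ring

theorem _root_.Int.sub_one_ediv_of_not_dvd {a L : ℤ} (hL : 0 < L) (h : ¬ L ∣ a) :
    a / L ≤ (a - 1) / L := by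
  rw [Int.le_ediv_iff_mul_le hL]
  have h1 := Int.ediv_mul_le a hL.ne'
  have h2 : a / L * L ≠ a := fun h' => h (Dvd.intro_left _ h')
  omega

/-- The edge `e` is integral for `f` exactly when its length divides its slope numerator. -/
theorem exists_dd_eq_intCast_iff {ℓ : G.EO → ℕ} (hℓpos : ∀ e, 0 < ℓ e)
    (hℓsym : ∀ e, ℓ (G.rev e) = ℓ e) {m : G.EO → ℤ} (hm : G.IsC1 m)
    (f : G.V → ℤ) (e : G.EO) :
    (∃ z : ℤ, G.dd ℓ m 1 f e = (z : ℚ)) ↔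
      (ℓ e : ℤ) ∣ f (G.head e) - f (G.tail e) + m e := by
  have hL : (0 : ℤ) < ℓ e := by exact_mod_cast hℓpos e
  have key := Int.ediv_add_neg_ediv (f (G.head e) - f (G.tail e) + m e) hL
  rw [dd, ddelta_one_rev hℓsym hm, ddelta_one]
  generalize f (G.head e) - f (G.tail e) + m e = a at *
  constructor
  · rintro ⟨z, hz⟩
    rcases key with ⟨h, -⟩ | ⟨-, h⟩
    · exact h
    · have h2 : a / (ℓ e : ℤ) - (-a) / (ℓ e : ℤ) = 2 * z := by
        have : ((a / (ℓ e : ℤ) : ℤ) : ℚ) - ((-a / (ℓ e : ℤ) : ℤ) : ℚ) = 2 * z := by linarith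
        exact_mod_cast this
      omega
  · intro hd
    rcases key with ⟨-, h⟩ | ⟨h, -⟩
    · refine ⟨a / (ℓ e : ℤ), ?_⟩
      have h2 : -a / (ℓ e : ℤ) = -(a / (ℓ e : ℤ)) := by omega
      rw [h2]
      push_cast
      ring
    · exact absurd hd h

theorem dvd_slope_rev_iff {ℓ : G.EO → ℕ} (hℓsym : ∀ e, ℓ (G.rev e) = ℓ e)
    {m : G.EO → ℤ} (hm : G.IsC1 m) (f : G.V → ℤ) (e : G.EO) :
    (ℓ (G.rev e) : ℤ) ∣ f (G.head (G.rev e)) - f (G.tail (G.rev e)) + m (G.rev e) ↔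
      (ℓ e : ℤ) ∣ f (G.head e) - f (G.tail e) + m e := by
  rw [hℓsym, hm, G.head_rev, G.tail_rev, ← dvd_neg]
  ring_nf

theorem dvd_slope_of_ddelta_le {ℓ : G.EO → ℕ} (hℓpos : ∀ e, 0 < ℓ e)
    (hℓsym : ∀ e, ℓ (G.rev e) = ℓ e) {m : G.EO → ℤ} (hm : G.IsC1 m)
    {f h : G.V → ℤ} (hfh : ∀ e, G.ddelta ℓ m 1 f e ≤ G.ddelta ℓ m 1 h e) (e : G.EO)
    (hf : (ℓ e : ℤ) ∣ f (G.head e) - f (G.tail e) + m e) :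
    (ℓ e : ℤ) ∣ h (G.head e) - h (G.tail e) + m e := by
  have hL : (0 : ℤ) < ℓ e := by exact_mod_cast hℓpos e
  have h1 := hfh e
  have h2 := hfh (G.rev e)
  rw [ddelta_one, ddelta_one] at h1
  rw [ddelta_one_rev hℓsym hm, ddelta_one_rev hℓsym hm] at h2
  rcases Int.ediv_add_neg_ediv (f (G.head e) - f (G.tail e) + m e) hL with ⟨-, k1⟩ | ⟨k1, -⟩
  · rcases Int.ediv_add_neg_ediv (h (G.head e) - h (G.tail e) + m e) hL with ⟨k2, -⟩ | ⟨-, k2⟩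
    · exact k2
    · omega
  · exact absurd hf k1

theorem abs_dd_sub_dd_le_of_ddelta_le {ℓ : G.EO → ℕ} (hℓpos : ∀ e, 0 < ℓ e)
    (hℓsym : ∀ e, ℓ (G.rev e) = ℓ e) {m : G.EO → ℤ} (hm : G.IsC1 m)
    {f h : G.V → ℤ} (hfh : ∀ e, G.ddelta ℓ m 1 f e ≤ G.ddelta ℓ m 1 h e) (e : G.EO) :
    |G.dd ℓ m 1 h e - G.dd ℓ m 1 f e| ≤ 1 / 2 := by
  have hL : (0 : ℤ) < ℓ e := by exact_mod_cast hℓpos e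
  have h1 := hfh e
  have h2 := hfh (G.rev e)
  have kf := Int.ediv_add_neg_ediv (f (G.head e) - f (G.tail e) + m e) hL
  have kh := Int.ediv_add_neg_ediv (h (G.head e) - h (G.tail e) + m e) hL
  rw [← ddelta_one_rev hℓsym hm, ← ddelta_one] at kf kh
  unfold dd
  generalize G.ddelta ℓ m 1 f e = a at *
  generalize G.ddelta ℓ m 1 h e = b at *
  generalize G.ddelta ℓ m 1 f (G.rev e) = c at *
  generalize G.ddelta ℓ m 1 h (G.rev e) = d at *
  have u1 : b - d - (a - c) ≤ 1 := by omega
  have u2 : -1 ≤ b - d - (a - c) := by omega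
  have v1 : (b : ℚ) - d - (a - c) ≤ 1 := by exact_mod_cast u1
  have v2 : -1 ≤ (b : ℚ) - d - (a - c) := by exact_mod_cast u2
  rw [abs_le]
  constructor <;> linarith

theorem head_le_of_ddelta_le {ℓ : G.EO → ℕ} (hℓpos : ∀ e, 0 < ℓ e)
    (hℓsym : ∀ e, ℓ (G.rev e) = ℓ e) {m : G.EO → ℤ} (hm : G.IsC1 m)
    {f h : G.V → ℤ} (hfh : ∀ e, G.ddelta ℓ m 1 f e ≤ G.ddelta ℓ m 1 h e) (e : G.EO) :
    h (G.head e) ≤ h (G.tail e) - m e - G.ddelta ℓ m 1 f (G.rev e) * ℓ e := by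
  have hL : (0 : ℤ) < ℓ e := by exact_mod_cast hℓpos e
  have h2 := hfh (G.rev e)
  rw [ddelta_one_rev hℓsym hm h, Int.le_ediv_iff_mul_le hL] at h2
  linarith

/-- Functions dominating the slopes of `f` with a prescribed value at `v₀` are bounded above
at every vertex. -/
theorem exists_forall_le_of_ddelta_le (hconn : G.Connected) {ℓ : G.EO → ℕ}
    (hℓpos : ∀ e, 0 < ℓ e) (hℓsym : ∀ e, ℓ (G.rev e) = ℓ e) {m : G.EO → ℤ} (hm : G.IsC1 m)
    (f : G.V → ℤ) (v₀ : G.V) (c : ℤ) (v : G.V) :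
    ∃ C : ℤ, ∀ h : G.V → ℤ, h v₀ = c →
      (∀ e, G.ddelta ℓ m 1 f e ≤ G.ddelta ℓ m 1 h e) → h v ≤ C := by
  induction hconn v₀ v with
  | refl => exact ⟨c, fun h hc _ => hc.le⟩
  | tail _ hadj ih =>
    obtain ⟨C, hC⟩ := ih
    obtain ⟨e, rfl, rfl⟩ := hadj
    refine ⟨C - m e - G.ddelta ℓ m 1 f (G.rev e) * ℓ e, fun h hc hfh => ?_⟩
    have h1 := hC h hc hfh
    have h2 := head_le_of_ddelta_le hℓpos hℓsym hm hfh e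
    linarith

/-- Raising `h` by one off a set all of whose entering edges are non-integral does not decrease
any of the integers `ddelta`. -/
theorem ddelta_le_ddelta_add_indicator {ℓ : G.EO → ℕ} (hℓpos : ∀ e, 0 < ℓ e)
    {m : G.EO → ℤ} (h : G.V → ℤ) (S : Set G.V)
    (hS : ∀ e, G.tail e ∉ S → G.head e ∈ S →
      ¬ (ℓ e : ℤ) ∣ h (G.head e) - h (G.tail e) + m e) (e : G.EO) :
    G.ddelta ℓ m 1 h e ≤ G.ddelta ℓ m 1 (fun v => h v + if v ∈ S then 0 else 1) e := by
  have hL : (0 : ℤ) < ℓ e := by exact_mod_cast hℓpos e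
  rw [ddelta_one, ddelta_one]
  by_cases ht : G.tail e ∈ S
  · refine Int.ediv_le_ediv hL ?_
    simp only [ht, if_true]
    split_ifs <;> omega
  · by_cases hh : G.head e ∈ S
    · refine (Int.sub_one_ediv_of_not_dvd hL (hS e ht hh)).trans
        (Int.ediv_le_ediv hL ?_)
      simp only [ht, hh, if_true, if_false]
      omega
    · refine Int.ediv_le_ediv hL ?_
      simp only [ht, hh, if_false]
      omega

/-- Some function dominating the slopes of `f` has all vertices reachable from `v₀` along
integral edges. -/
theorem exists_ddelta_le_and_reachable (hconn : G.Connected) {ℓ : G.EO → ℕ}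
    (hℓpos : ∀ e, 0 < ℓ e) (hℓsym : ∀ e, ℓ (G.rev e) = ℓ e) {m : G.EO → ℤ} (hm : G.IsC1 m)
    (f : G.V → ℤ) (v₀ : G.V) :
    ∃ h : G.V → ℤ, (∀ e, G.ddelta ℓ m 1 f e ≤ G.ddelta ℓ m 1 h e) ∧
      ∀ v, Relation.ReflTransGen
        (fun a b => ∃ e, (ℓ e : ℤ) ∣ h (G.head e) - h (G.tail e) + m e ∧
          G.tail e = a ∧ G.head e = b) v₀ v := by
  choose C hC using exists_forall_le_of_ddelta_le hconn hℓpos hℓsym hm f v₀ (f v₀)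
  obtain ⟨s, ⟨h, hv₀, hfh, rfl⟩, hmax⟩ := Int.exists_greatest_of_bdd
    (P := fun s => ∃ h : G.V → ℤ, h v₀ = f v₀ ∧
      (∀ e, G.ddelta ℓ m 1 f e ≤ G.ddelta ℓ m 1 h e) ∧ ∑ v, h v = s)
    ⟨∑ v, C v, by
      rintro _ ⟨h, hv₀, hfh, rfl⟩
      exact Finset.sum_le_sum fun v _ => hC v h hv₀ hfh⟩
    ⟨_, f, rfl, fun _ => le_rfl, rfl⟩
  refine ⟨h, hfh, ?_⟩
  by_contra! hne
  obtain ⟨w, hw⟩ := hne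
  set S : Set G.V := {v | Relation.ReflTransGen
        (fun a b => ∃ e, (ℓ e : ℤ) ∣ h (G.head e) - h (G.tail e) + m e ∧
          G.tail e = a ∧ G.head e = b) v₀ v}
  have hv₀S : v₀ ∈ S := Relation.ReflTransGen.refl
  have hwS : w ∉ S := hw
  have hS : ∀ e, G.tail e ∉ S → G.head e ∈ S →
      ¬ (ℓ e : ℤ) ∣ h (G.head e) - h (G.tail e) + m e := by
    intro e ht hh hd
    exact ht (Relation.ReflTransGen.tail hh
      ⟨G.rev e, (dvd_slope_rev_iff hℓsym hm h e).2 hd, G.tail_rev e, G.head_rev e⟩)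
  have hle := hmax _ ⟨fun v => h v + if v ∈ S then 0 else 1, by simp [hv₀S, hv₀],
    fun e => (hfh e).trans (ddelta_le_ddelta_add_indicator hℓpos h S hS e), rfl⟩
  refine absurd hle (not_le.2 (Finset.sum_lt_sum (fun v _ => ?_) ⟨w, Finset.mem_univ w, ?_⟩))
  · split_ifs <;> omega
  · simp [hwS]

end OrGraph

/-- for every `f` there is `h` such that `G^𝔪_h` is connected,
contains `G^𝔪_f`, and `|𝔡^𝔪_h - 𝔡^𝔪_f| ≤ 1/2` everywhere. -/
theorem exists_connected_close (G : OrGraph) (hconn : G.Connected)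
    (ℓ : G.EO → ℕ) (hℓpos : ∀ e, 0 < ℓ e) (hℓsym : ∀ e, ℓ (G.rev e) = ℓ e)
    (m : G.EO → ℤ) (hm : G.IsC1 m)
    (f : G.V → ℤ) :
    ∃ h : G.V → ℤ,
      (∀ u v : G.V, Relation.ReflTransGen
        (fun a b => ∃ e, (∃ z : ℤ, G.dd ℓ m 1 h e = (z : ℚ)) ∧
          G.tail e = a ∧ G.head e = b) u v) ∧
      (∀ e, (∃ z : ℤ, G.dd ℓ m 1 f e = (z : ℚ)) →
        ∃ z : ℤ, G.dd ℓ m 1 h e = (z : ℚ)) ∧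
      (∀ e, |G.dd ℓ m 1 h e - G.dd ℓ m 1 f e| ≤ 1 / 2) := by
  rcases isEmpty_or_nonempty G.V with hV | ⟨⟨v₀⟩⟩
  · exact ⟨f, fun u => isEmptyElim u, fun _ he => he, fun e => by simp⟩
  obtain ⟨h, hfh, hreach⟩ :=
    OrGraph.exists_ddelta_le_and_reachable hconn hℓpos hℓsym hm f v₀
  refine ⟨h, fun u v => ?_, fun e => ?_,
    OrGraph.abs_dd_sub_dd_le_of_ddelta_le hℓpos hℓsym hm hfh⟩
  · simp only [OrGraph.exists_dd_eq_intCast_iff hℓpos hℓsym hm]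
    refine Relation.ReflTransGen.trans
      ((@Relation.ReflTransGen.stdSymm _ _ ⟨?_⟩).symm _ _ (hreach u)) (hreach v)
    rintro _ _ ⟨e, hd, rfl, rfl⟩
    exact ⟨G.rev e, (OrGraph.dvd_slope_rev_iff hℓsym hm h e).2 hd, G.tail_rev e, G.head_rev e⟩
  · simp only [OrGraph.exists_dd_eq_intCast_iff hℓpos hℓsym hm]
    exact OrGraph.dvd_slope_of_ddelta_le hℓpos hℓsym hm hfh e
end

section
/- Let β ∈ C^1(G,ℤ) and h: E → ℤ≥0. Suppose that for every γ ∈ H^1(G,ℤ) one has |∑_{e∈E^𝔬} β_e γ_e| ≤ ∑_{e∈E^𝔬} h(e)|γ_e|. Then there exists η ∈ C^1(G,ℤ) such that |η_e| ≤ h(e) for every e ∈ 𝔼 (where h(e) denotes the value on the underlying edge), and ∑_{e∈E^𝔬} β_e γ_e = ∑_{e∈E^𝔬} η_e γ_e for every γ ∈ H^1(G,ℤ). -/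
open scoped Classical

namespace OrGraph

variable {G : OrGraph}

lemma isC1_chi (e : G.EO) : G.IsC1 (G.chi ℤ e) := by
  intro x
  have h1 := G.rev_ne e
  have h2 := G.rev_rev e
  have h3 := G.rev_rev x
  unfold chi
  grind

lemma IsC1.add_s11 {g g' : G.EO → ℤ} (hg : G.IsC1 g) (hg' : G.IsC1 g') : G.IsC1 (g + g') := by
  intro e
  simp only [Pi.add_apply, hg e, hg' e]
  ring

lemma IsC1.sub {g g' : G.EO → ℤ} (hg : G.IsC1 g) (hg' : G.IsC1 g') : G.IsC1 (g - g') := by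
  intro e
  simp only [Pi.sub_apply, hg e, hg' e]
  ring

lemma isC1_d_s11 (f : G.V → ℤ) : G.IsC1 (G.d f) := by
  intro e
  simp [d, G.head_rev, G.tail_rev]

lemma dstar_add_s11 (g g' : G.EO → ℤ) : G.dstar (g + g') = G.dstar g + G.dstar g' := by
  ext v
  simp [dstar, Finset.sum_add_distrib]

lemma dstar_sub (g g' : G.EO → ℤ) : G.dstar (g - g') = G.dstar g - G.dstar g' := by
  ext v
  simp [dstar, Finset.sum_sub_distrib]

lemma dstar_chi (e : G.EO) :
    G.dstar (G.chi ℤ e) = Pi.single (G.head e) 1 - Pi.single (G.tail e) 1 := by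
  have hchi : G.chi ℤ e = fun x => (if x = e then 1 else 0) - if x = G.rev e then 1 else 0 := by
    have h1 := G.rev_ne e
    ext x
    unfold chi
    grind
  ext v
  simp only [dstar, hchi, Finset.sum_sub_distrib, Finset.sum_ite_eq', Finset.mem_filter,
    Finset.mem_univ, true_and, G.head_rev, Pi.sub_apply, Pi.single_apply]
  grind

/-- A function on oriented edges that is invariant under reversal and supported on the edge
underlying `e` sums to its value at `e` over any orientation. -/
lemma sum_orientation_eq_single {O : Finset G.EO} (hO : ∀ e, e ∈ O ↔ G.rev e ∉ O)
    {φ : G.EO → ℤ} (hφ : ∀ x, φ (G.rev x) = φ x) (e : G.EO)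
    (h0 : ∀ x, x ≠ e → x ≠ G.rev e → φ x = 0) : ∑ x ∈ O, φ x = φ e := by
  by_cases he : e ∈ O
  · refine Finset.sum_eq_single_of_mem e he fun x hx hxe => h0 x hxe ?_
    rintro rfl
    exact (hO e).1 he hx
  · have he' : G.rev e ∈ O := by
      by_contra hc
      exact he ((hO e).2 hc)
    rw [← hφ e]
    refine Finset.sum_eq_single_of_mem _ he' fun x hx hxe => h0 x ?_ hxe
    rintro rfl
    exact he hx

/-- A sum over all oriented edges splits along an orientation. -/
lemma sum_univ_eq_sum_orientation {O : Finset G.EO} (hO : ∀ e, e ∈ O ↔ G.rev e ∉ O)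
    (φ : G.EO → ℤ) : ∑ x, φ x = ∑ x ∈ O, (φ x + φ (G.rev x)) := by
  rw [Finset.sum_add_distrib, ← Finset.sum_add_sum_compl O φ]
  congr 1
  refine Finset.sum_bij' (fun x _ => G.rev x) (fun x _ => G.rev x) ?_ ?_ ?_ ?_ ?_
  · intro x hx
    by_contra hc
    exact Finset.mem_compl.1 hx ((hO x).2 hc)
  · intro x hx
    exact Finset.mem_compl.2 ((hO x).1 hx)
  · exact fun x _ => G.rev_rev x
  · exact fun x _ => G.rev_rev x
  · exact fun x _ => by rw [G.rev_rev]

/-- The cut space is orthogonal to the cycle space. -/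
lemma sum_d_mul_eq_zero {O : Finset G.EO} (hO : ∀ e, e ∈ O ↔ G.rev e ∉ O)
    (f : G.V → ℤ) {γ : G.EO → ℤ} (hγ : G.IsC1 γ) (hd : G.dstar γ = 0) :
    ∑ e ∈ O, G.d f e * γ e = 0 := by
  have h1 : ∑ e ∈ O, G.d f e * γ e = ∑ e, f (G.head e) * γ e := by
    rw [sum_univ_eq_sum_orientation hO]
    refine Finset.sum_congr rfl fun e _ => ?_
    rw [G.head_rev, hγ e, d]
    ring
  rw [h1, ← Finset.sum_fiberwise Finset.univ G.head]
  refine Finset.sum_eq_zero fun v _ => ?_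
  have h2 : ∑ e ∈ Finset.univ.filter (fun e => G.head e = v), γ e = 0 := congrFun hd v
  calc _ = ∑ e ∈ Finset.univ.filter (fun e => G.head e = v), f v * γ e :=
        Finset.sum_congr rfl fun e he => by rw [(Finset.mem_filter.1 he).2]
    _ = 0 := by rw [← Finset.mul_sum, h2, mul_zero]

/-- In a connected graph every difference of two vertices bounds an integral 1-cochain. -/
lemma Connected.exists_dstar_eq (hconn : G.Connected) (u v : G.V) :
    ∃ γ : G.EO → ℤ, G.IsC1 γ ∧ G.dstar γ = Pi.single v 1 - Pi.single u 1 := by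
  induction hconn u v with
  | refl => exact ⟨0, fun e => by simp, by ext; simp [dstar]⟩
  | tail _ hadj ih =>
    obtain ⟨γ, hγ, hd⟩ := ih
    obtain ⟨e, rfl, rfl⟩ := hadj
    exact ⟨γ + G.chi ℤ e, hγ.add_s11 (isC1_chi e), by rw [dstar_add_s11, hd, dstar_chi]; abel⟩

/-- A potential with prescribed upper bounds `β + h` on its increments: at `v`, take the least cost
`∑ (β γ + h |γ|)` of a 1-cochain `γ` with boundary `v - u`, for a fixed base vertex `u`. -/
lemma exists_d_le (hconn : G.Connected)
    {O : Finset G.EO} (hO : ∀ e, e ∈ O ↔ G.rev e ∉ O)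
    {β : G.EO → ℤ} (hβ : G.IsC1 β)
    {h : G.EO → ℤ} (hsym : ∀ e, h (G.rev e) = h e) (hpos : ∀ e, 0 ≤ h e)
    (hineq : ∀ γ : G.EO → ℤ, G.IsC1 γ → G.dstar γ = 0 →
      |∑ e ∈ O, β e * γ e| ≤ ∑ e ∈ O, h e * |γ e|) :
    ∃ f : G.V → ℤ, ∀ e, G.d f e ≤ β e + h e := by
  rcases isEmpty_or_nonempty G.V with hV | ⟨⟨u⟩⟩
  · exact ⟨0, fun e => hV.elim (G.head e)⟩
  let cost : (G.EO → ℤ) → ℤ := fun γ => ∑ e ∈ O, (β e * γ e + h e * |γ e|)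
  let S : G.V → Set ℤ := fun v =>
    cost '' {γ | G.IsC1 γ ∧ G.dstar γ = Pi.single v 1 - Pi.single u 1}
  have hne (v) : (S v).Nonempty := Set.Nonempty.image _ (hconn.exists_dstar_eq u v)
  have hbdd (v) : BddBelow (S v) := by
    obtain ⟨γ₀, h₀, hd₀⟩ := hconn.exists_dstar_eq u v
    refine ⟨∑ e ∈ O, (β e * γ₀ e - h e * |γ₀ e|), ?_⟩
    rintro _ ⟨γ, ⟨hγ, hd⟩, rfl⟩
    have h1 := (abs_le.1 (hineq (γ - γ₀) (hγ.sub h₀) (by rw [dstar_sub, hd, hd₀, sub_self]))).1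
    have h2 : ∑ e ∈ O, h e * |(γ - γ₀) e| ≤ ∑ e ∈ O, h e * (|γ e| + |γ₀ e|) :=
      Finset.sum_le_sum fun e _ => mul_le_mul_of_nonneg_left (abs_sub _ _) (hpos e)
    simp only [cost, Pi.sub_apply, mul_sub, mul_add, Finset.sum_add_distrib,
      Finset.sum_sub_distrib] at h1 h2 ⊢
    linarith
  refine ⟨fun v => sInf (S v), fun e => ?_⟩
  obtain ⟨γ, ⟨hγ, hd⟩, hcost⟩ := Int.csInf_mem (hne (G.tail e)) (hbdd (G.tail e))
  have hmem : cost (γ + G.chi ℤ e) ∈ S (G.head e) :=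
    ⟨_, ⟨hγ.add_s11 (isC1_chi e), by rw [dstar_add_s11, hd, dstar_chi]; abel⟩, rfl⟩
  have hle := csInf_le (hbdd _) hmem
  have hchi : ∑ x ∈ O, (β x * G.chi ℤ e x + h x * |G.chi ℤ e x|) = β e + h e := by
    rw [sum_orientation_eq_single hO _ e]
    · simp [chi]
    · intro x h1 h2
      simp [chi, h1, h2]
    · intro x
      rw [isC1_chi e x, hβ x, hsym x, abs_neg]
      ring
  have hsub : cost (γ + G.chi ℤ e) ≤
      cost γ + ∑ x ∈ O, (β x * G.chi ℤ e x + h x * |G.chi ℤ e x|) := by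
    simp only [cost, ← Finset.sum_add_distrib, Pi.add_apply]
    refine Finset.sum_le_sum fun x _ => ?_
    have := mul_le_mul_of_nonneg_left (abs_add_le (γ x) (G.chi ℤ e x)) (hpos x)
    linarith
  simp only [d]
  linarith

end OrGraph

/-- Lemma 5.5: if `|∑ β_e γ_e| ≤ ∑ h(e)|γ_e|` for all
`γ ∈ H^1(G,ℤ)`, then there is `η ∈ C^1(G,ℤ)` with `|η_e| ≤ h(e)` and
`∑ β_e γ_e = ∑ η_e γ_e` for all `γ ∈ H^1(G,ℤ)`. -/
theorem exists_eta_bounded (G : OrGraph) (hconn : G.Connected)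
    (O : Finset G.EO) (hO : ∀ e, e ∈ O ↔ G.rev e ∉ O)
    (β : G.EO → ℤ) (hβ : G.IsC1 β)
    (h : G.EO → ℤ) (hsym : ∀ e, h (G.rev e) = h e) (hpos : ∀ e, 0 ≤ h e)
    (hineq : ∀ γ : G.EO → ℤ, G.IsC1 γ → G.dstar γ = 0 →
      |∑ e ∈ O, β e * γ e| ≤ ∑ e ∈ O, h e * |γ e|) :
    ∃ η : G.EO → ℤ, G.IsC1 η ∧ (∀ e, |η e| ≤ h e) ∧
      ∀ γ : G.EO → ℤ, G.IsC1 γ → G.dstar γ = 0 →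
        ∑ e ∈ O, β e * γ e = ∑ e ∈ O, η e * γ e := by
  obtain ⟨f, hf⟩ := OrGraph.exists_d_le hconn hO hβ hsym hpos hineq
  refine ⟨β - G.d f, hβ.sub (OrGraph.isC1_d_s11 f), fun e => ?_, fun γ hγ hd => ?_⟩
  · have h1 := hf e
    have h2 := hf (G.rev e)
    rw [OrGraph.isC1_d_s11 f e, hβ e, hsym e] at h2
    rw [Pi.sub_apply, abs_le]
    constructor <;> linarith
  · have h0 := OrGraph.sum_d_mul_eq_zero hO f hγ hd
    simp only [Pi.sub_apply, sub_mul, Finset.sum_sub_distrib, h0, sub_zero]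
end
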